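/- Under hypotheses (H0)-(H4), a nonnegative function h on ℤ^{d−1}×ℕ is harmonic for the Markov chain (Z(t)) if and only if there exists a positive Borel measure ν on the compact set (Θ×ℝ)∩∂₊D ⊂ ℝ^d such that h(z) = ∫_{(Θ×ℝ)∩∂₊D} h_a(z) dν(a) for all z ∈ ℤ^{d−1}×ℕ. -/

import Mathlib

open scoped ENNReal
open Filter MeasureTheory

namespace ReflectedRW

/-- `ℤ^d` realized as `ℤ^{d-1} × ℤ`. -/
abbrev Zd (d : ℕ) := (Fin (d-1) → ℤ) × ℤ
/-- `ℝ^d` realized as `ℝ^{d-1} × ℝ`. -/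
abbrev Rd (d : ℕ) := (Fin (d-1) → ℝ) × ℝ
/-- The state space `ℤ^{d-1} × ℕ` of the reflected walk. -/
abbrev St (d : ℕ) := (Fin (d-1) → ℤ) × ℕ

/-- Embedding of the state space into `ℤ^d`. -/
def toZ (d : ℕ) (z : St d) : Zd d := (z.1, (z.2 : ℤ))

/-- Embedding of `ℤ^d` into `ℝ^d`. -/
def toR (d : ℕ) (z : Zd d) : Rd d := (fun i => (z.1 i : ℝ), (z.2 : ℝ))

/-- Scalar product `a · z` of `a ∈ ℝ^d` and `z ∈ ℤ^d`. -/
noncomputable def dotZ (d : ℕ) (a : Rd d) (z : Zd d) : ℝ :=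
  (∑ i, a.1 i * (z.1 i : ℝ)) + a.2 * (z.2 : ℝ)

/-- Scalar product on `ℝ^d`. -/
noncomputable def dotR (d : ℕ) (a q : Rd d) : ℝ :=
  (∑ i, a.1 i * q.1 i) + a.2 * q.2

/-- One-step transition probabilities of the reflected random walk `Z(t)`:
jumps with law `μ` in the interior and with law `μ0` on the boundary `y = 0`. -/
noncomputable def step (d : ℕ) (μ μ0 : Zd d → ℝ) (z z' : St d) : ℝ≥0∞ :=
  if z.2 = 0 then ENNReal.ofReal (μ0 (toZ d z' - toZ d z))
  else ENNReal.ofReal (μ (toZ d z' - toZ d z))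

/-- Real-valued version of the transition kernel of `Z(t)`. -/
noncomputable def stepR (d : ℕ) (μ μ0 : Zd d → ℝ) (z z' : St d) : ℝ :=
  if z.2 = 0 then μ0 (toZ d z' - toZ d z) else μ (toZ d z' - toZ d z)

/-- `n`-step kernel obtained by iterating a sub-Markov kernel `p`. -/
noncomputable def kerIter {S : Type*} [DecidableEq S] (p : S → S → ℝ≥0∞) :
    ℕ → S → S → ℝ≥0∞
  | 0, z, z' => if z = z' then 1 else 0
  | n+1, z, z' => ∑' w : S, kerIter p n z w * p w z'

/-- `n`-step transition probabilities of `Z(t)`: `P_z(Z(n) = z')`. -/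
noncomputable def stepn (d : ℕ) (μ μ0 : Zd d → ℝ) : ℕ → St d → St d → ℝ≥0∞ :=
  kerIter (step d μ μ0)

/-- Green's function `G(z,z') = ∑_{t ≥ 0} P_z(Z(t) = z')` of the reflected walk. -/
noncomputable def green (d : ℕ) (μ μ0 : Zd d → ℝ) (z z' : St d) : ℝ≥0∞ :=
  ∑' n : ℕ, stepn d μ μ0 n z z'

/-- Kernel of the walk killed upon hitting the boundary hyperplane `y = 0`. -/
noncomputable def stepKilled (d : ℕ) (μ μ0 : Zd d → ℝ) (z z' : St d) : ℝ≥0∞ :=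
  if z'.2 = 0 then 0 else step d μ μ0 z z'

/-- `n`-step kernel of the killed walk: `P_z(Z(n) = z', τ > n)` where
`τ` is the first return time to the boundary hyperplane. -/
noncomputable def stepKilledn (d : ℕ) (μ μ0 : Zd d → ℝ) : ℕ → St d → St d → ℝ≥0∞ :=
  kerIter (stepKilled d μ μ0)

/-- Green's function `G₊(z,z')` of the killed walk. -/
noncomputable def greenPlus (d : ℕ) (μ μ0 : Zd d → ℝ) (z z' : St d) : ℝ≥0∞ :=
  ∑' n : ℕ, stepKilledn d μ μ0 n z z'

/-- One-step kernel of the homogeneous random walk `S(t)` on `ℤ^d`. -/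
noncomputable def stepS (d : ℕ) (μ : Zd d → ℝ) (z z' : Zd d) : ℝ≥0∞ :=
  ENNReal.ofReal (μ (z' - z))

/-- `n`-step kernel of the homogeneous random walk on `ℤ^d`. -/
noncomputable def stepSn (d : ℕ) (μ : Zd d → ℝ) : ℕ → Zd d → Zd d → ℝ≥0∞ :=
  kerIter (stepS d μ)

/-- Green's function `G_S` of the homogeneous random walk on `ℤ^d`. -/
noncomputable def greenS (d : ℕ) (μ : Zd d → ℝ) (z z' : Zd d) : ℝ≥0∞ :=
  ∑' n : ℕ, stepSn d μ n z z'

/-- `hitProb z w = P_z(τ < ∞, Z(τ) = w)`, the hitting distribution on the boundary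
hyperplane, `τ = inf{t ≥ 1 : Z(t) ∈ ℤ^{d-1}×{0}}`. -/
noncomputable def hitProb (d : ℕ) (μ μ0 : Zd d → ℝ) (z w : St d) : ℝ≥0∞ :=
  if w.2 = 0 then
    ∑' n : ℕ, ∑' v : St d, stepKilledn d μ μ0 n z v * step d μ μ0 v w
  else 0

/-- The jump generating function `φ(a) = ∑_z μ(z) e^{a·z}`. -/
noncomputable def jgf (d : ℕ) (μ : Zd d → ℝ) (a : Rd d) : ℝ :=
  ∑' z : Zd d, μ z * Real.exp (dotZ d a z)

/-- Partial derivative `∂φ/∂β` of the jump generating function in the last coordinate. -/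
noncomputable def jgfDβ (d : ℕ) (μ : Zd d → ℝ) (a : Rd d) : ℝ :=
  ∑' z : Zd d, μ z * (z.2 : ℝ) * Real.exp (dotZ d a z)

/-- Gradient `∇φ(a)` of the jump generating function. -/
noncomputable def jgfGrad (d : ℕ) (μ : Zd d → ℝ) (a : Rd d) : Rd d :=
  (fun i => ∑' z : Zd d, μ z * (z.1 i : ℝ) * Real.exp (dotZ d a z), jgfDβ d μ a)

/-- The set `D = {a : φ(a) ≤ 1}`. -/
def Dset (d : ℕ) (μ : Zd d → ℝ) : Set (Rd d) := {a | jgf d μ a ≤ 1}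

/-- `∂₊D`: points of the boundary of `D` where the last coordinate of `∇φ` is `≥ 0`. -/
def bdPlus (d : ℕ) (μ : Zd d → ℝ) : Set (Rd d) :=
  {a | jgf d μ a = 1 ∧ 0 ≤ jgfDβ d μ a}

/-- `∂₋D`: points of the boundary of `D` where the last coordinate of `∇φ` is `≤ 0`. -/
def bdMinus (d : ℕ) (μ : Zd d → ℝ) : Set (Rd d) :=
  {a | jgf d μ a = 1 ∧ jgfDβ d μ a ≤ 0}

/-- `∂₀D`: points of the boundary of `D` where the last coordinate of `∇φ` is `0`. -/
def bdZero (d : ℕ) (μ : Zd d → ℝ) : Set (Rd d) :=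
  {a | jgf d μ a = 1 ∧ jgfDβ d μ a = 0}

/-- `Θ = {α ∈ ℝ^{d-1} : inf_β max(φ(α,β), φ₀(α,β)) ≤ 1}`. -/
noncomputable def Theta (d : ℕ) (μ μ0 : Zd d → ℝ) : Set (Fin (d-1) → ℝ) :=
  {α | (⨅ β : ℝ, max (jgf d μ (α, β)) (jgf d μ0 (α, β))) ≤ 1}

/-- `D̂ = (Θ×ℝ) ∩ D`. -/
noncomputable def Dhat (d : ℕ) (μ μ0 : Zd d → ℝ) : Set (Rd d) :=
  {a | a.1 ∈ Theta d μ μ0 ∧ jgf d μ a ≤ 1}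

/-- Normal cone to a convex set `s ⊆ ℝ^d` at the point `a`. -/
noncomputable def normalCone (d : ℕ) (s : Set (Rd d)) (a : Rd d) : Set (Rd d) :=
  {q | ∀ b ∈ s, dotR d q (b - a) ≤ 0}

/-- The mean vector `m = ∑_z z μ(z)`. -/
noncomputable def meanVec (d : ℕ) (μ : Zd d → ℝ) : Rd d :=
  (fun i => ∑' z : Zd d, μ z * (z.1 i : ℝ), ∑' z : Zd d, μ z * (z.2 : ℝ))

/-- The harmonic functions `h_a` of (1-8), for `a ∈ D̂ ∩ ∂₊D` with associated
point `abar = ā ∈ ∂₋D` (same first `d-1` coordinates as `a`). -/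
noncomputable def hfun (d : ℕ) (μ μ0 : Zd d → ℝ) (a abar : Rd d) (z : St d) : ℝ :=
  if jgf d μ0 abar = 1 then Real.exp (dotZ d abar (toZ d z))
  else if a = abar then
    (z.2 : ℝ) * Real.exp (dotZ d a (toZ d z))
      + (jgfDβ d μ0 a / (1 - jgf d μ0 a)) * Real.exp (dotZ d a (toZ d z))
  else
    Real.exp (dotZ d a (toZ d z))
      - ((1 - jgf d μ0 a) / (1 - jgf d μ0 abar)) * Real.exp (dotZ d abar (toZ d z))

/-- `h : ℤ^{d-1}×ℕ → ℝ` is harmonic for the reflected walk. -/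
def IsHarmonic (d : ℕ) (μ μ0 : Zd d → ℝ) (h : St d → ℝ) : Prop :=
  ∀ z : St d, HasSum (fun z' => stepR d μ μ0 z z' * h z') (h z)

/-- Minimal nonnegative harmonic function. -/
def IsMinimalHarmonic (d : ℕ) (μ μ0 : Zd d → ℝ) (h : St d → ℝ) : Prop :=
  IsHarmonic d μ μ0 h ∧ (∀ z, 0 ≤ h z) ∧ h ≠ 0 ∧
    ∀ h' : St d → ℝ, IsHarmonic d μ μ0 h' → (∀ z, 0 ≤ h' z) → h' ≠ 0 →
      (∀ z, h' z ≤ h z) → ∃ c : ℝ, 0 < c ∧ h' = fun z => c * h z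

/- Hypotheses (H0)–(H4). -/

/-- `(H0)`: `μ(x,y) = 0` for `y < -1` and `μ₀(x,y) = 0` for `y < 0`. -/
def H0 (d : ℕ) (μ μ0 : Zd d → ℝ) : Prop :=
  (∀ z : Zd d, z.2 < -1 → μ z = 0) ∧ (∀ z : Zd d, z.2 < 0 → μ0 z = 0)

/-- `(H1)`: the reflected walk is irreducible on `ℤ^{d-1}×ℕ`. -/
def H1 (d : ℕ) (μ μ0 : Zd d → ℝ) : Prop :=
  ∀ z z' : St d, ∃ n : ℕ, 0 < stepn d μ μ0 n z z'

/-- `(H2)`: the homogeneous walk with step law `μ` is irreducible on `ℤ^d` and its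
last coordinate is an aperiodic random walk on `ℤ`. -/
def H2 (d : ℕ) (μ : Zd d → ℝ) : Prop :=
  (∀ z z' : Zd d, ∃ n : ℕ, 0 < stepSn d μ n z z') ∧
    AddSubgroup.closure {y : ℤ | ∃ x : Fin (d-1) → ℤ, μ (x, y) ≠ 0} = ⊤

/-- `(H3)`: `m ≠ 0` and `m/|m| + m₀/|m₀| ≠ 0`. -/
noncomputable def H3 (d : ℕ) (μ μ0 : Zd d → ℝ) : Prop :=
  meanVec d μ ≠ 0 ∧ meanVec d μ0 ≠ 0 ∧
    ‖meanVec d μ‖⁻¹ • meanVec d μ + ‖meanVec d μ0‖⁻¹ • meanVec d μ0 ≠ 0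

/-- `(H4)`: the jump generating functions are finite everywhere on `ℝ^d`. -/
def H4 (d : ℕ) (μ μ0 : Zd d → ℝ) : Prop :=
  ∀ a : Rd d, Summable (fun z : Zd d => μ z * Real.exp (dotZ d a z)) ∧
    Summable (fun z : Zd d => μ0 z * Real.exp (dotZ d a z))

/-- `μ` is a probability distribution on `ℤ^d`. -/
def IsProb (d : ℕ) (μ : Zd d → ℝ) : Prop :=
  (∀ z : Zd d, 0 ≤ μ z) ∧ HasSum μ 1


open Classical in
/-- The point `ā ∈ ∂₋D` with the same first `d-1` coordinates as `a`,
selected by choice. -/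
noncomputable def abarF (d : ℕ) (μ : Zd d → ℝ) (a : Rd d) : Rd d :=
  if h : ∃ b : Rd d, b ∈ bdMinus d μ ∧ b.1 = a.1 then h.choose else 0

theorem _root_.HasSum.of_eq {ι : Type*} {f g : ι → ℝ} {a b : ℝ} (h : HasSum f a)
    (hfg : ∀ i, g i = f i) (hab : b = a) : HasSum g b := by
  rw [hab, funext hfg]; exact h

/-- Minimum principle for a skip-free walk on `ℕ` with nonpositive drift. -/
theorem skipFree_minimum_principle {p F : ℕ → ℝ} (hp : ∀ j, 0 ≤ p j) (hp0 : 0 < p 0)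
    (hsum : HasSum p 1) (hmean : Summable fun j : ℕ => p j * j) (hdrift : ∑' j : ℕ, p j * j ≤ 1)
    (hF : ∀ y, 0 ≤ F y) (hharm : ∀ y, HasSum (fun j => p j * F (y + j)) (F (y + 1))) (y : ℕ) :
    F 0 ≤ F y := by
  by_contra! hlt
  set ε : ℝ := (F 0 - F y) / (2 * (y + 1)) with hε
  have hεpos : 0 < ε := div_pos (by linarith) (by positivity)
  set v : ℕ → ℝ := fun n => F n + ε * n with hv
  have hvy : v y < v 0 := by
    have : ε * (y + 1) = (F 0 - F y) / 2 := by rw [hε]; field_simp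
    simp only [hv, Nat.cast_zero, mul_zero, add_zero]
    nlinarith
  obtain ⟨N, hN⟩ := exists_nat_gt (F 0 / ε)
  have hbig : ∀ n, N ≤ n → v 0 < v n := by
    intro n hn
    have h1 : F 0 < ε * N := by rw [div_lt_iff₀ hεpos] at hN; linarith
    have h2 : (N : ℝ) ≤ n := by exact_mod_cast hn
    simp only [hv, Nat.cast_zero, mul_zero, add_zero]
    nlinarith [hF n]
  have hex : ∃ k, ∀ n, v k ≤ v n := by
    obtain ⟨k, hk, hmin⟩ := Finset.exists_min_image (Finset.range (max N y + 1)) v ⟨0, by simp⟩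
    refine ⟨k, fun n => ?_⟩
    by_cases hn : n < max N y + 1
    · exact hmin n (Finset.mem_range.2 hn)
    · have h0 := hmin 0 (by simp)
      exact h0.trans (hbig n (by omega)).le
  classical
  have hk := Nat.find_spec hex
  have hkmin := fun m (hm : m < Nat.find hex) => Nat.find_min hex hm
  obtain hz | ⟨k, hk1⟩ : Nat.find hex = 0 ∨ ∃ k, Nat.find hex = k + 1 := by
    cases Nat.find hex <;> simp
  · rw [hz] at hk
    exact absurd (hk y) (not_le.2 hvy)
  · rw [hk1] at hk hkmin
    have hlt' : v (k + 1) < v k := by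
      have := hkmin k (Nat.lt_succ_self k)
      push Not at this
      obtain ⟨n, hn⟩ := this
      exact (hk n).trans_lt hn
    have hs1 : HasSum (fun j => p j * v (k + j)) (F (k + 1) + ε * (1 * k + ∑' j : ℕ, p j * j)) := by
      have := (hharm k).add (((hsum.mul_right (k : ℝ)).add hmean.hasSum).mul_left ε)
      refine this.of_eq (fun j => ?_) (by ring)
      simp only [hv]; push_cast; ring
    have hs2 : HasSum (fun j => p j * v (k + 1)) (1 * v (k + 1)) := hsum.mul_right _
    have := hasSum_lt (i := 0) (fun j => mul_le_mul_of_nonneg_left (hk (k + j)) (hp j))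
      (mul_lt_mul_of_pos_left hlt' hp0) hs2 hs1
    simp only [hv] at this
    push_cast at this
    nlinarith

/-- Nonnegative solutions of a renewal equation are geometric sequences. -/
theorem geometric_of_renewal {p d : ℕ → ℝ} (hp : ∀ j, 0 ≤ p j) (hp0 : 0 < p 0)
    (hR : ∀ R : ℝ, Summable fun j => p j * R ^ j) (h2 : ∃ j, 2 ≤ j ∧ 0 < p j) (hd : ∀ n, 0 ≤ d n)
    (h : ∀ n, HasSum (fun j => p j * ∑ i ∈ Finset.range (j - 1), d (n + 1 + i)) (p 0 * d n)) :
    ∃ c : ℝ, 0 < c ∧ ∀ n, d n = d 0 * c ^ n := by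
  obtain ⟨J, hJ2, hJ⟩ := h2
  set M : ℝ := max (p 0 / p J) 1 with hM
  have hM1 : 1 ≤ M := le_max_right _ _
  have hstep : ∀ u : ℕ → ℝ, (∀ n, 0 ≤ u n) →
      (∀ n, HasSum (fun j => p j * ∑ i ∈ Finset.range (j - 1), u (n + 1 + i)) (p 0 * u n)) →
      ∀ n, u (n + 1) ≤ M * u n := by
    intro u hu hs n
    have h1 : p J * ∑ i ∈ Finset.range (J - 1), u (n + 1 + i) ≤ p 0 * u n :=
      le_hasSum (hs n) J fun j _ => mul_nonneg (hp j) (Finset.sum_nonneg fun i _ => hu _)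
    have h3 : u (n + 1) ≤ ∑ i ∈ Finset.range (J - 1), u (n + 1 + i) := by
      have := Finset.single_le_sum (f := fun i => u (n + 1 + i)) (fun i _ => hu _)
        (Finset.mem_range.2 (show 0 < J - 1 by omega))
      simpa using this
    have h4 : u (n + 1) ≤ p 0 / p J * u n := by
      rw [div_mul_eq_mul_div, le_div_iff₀ hJ]
      nlinarith
    exact h4.trans (mul_le_mul_of_nonneg_right (le_max_left _ _) (hu n))
  have hpow : ∀ u : ℕ → ℝ, (∀ n, u (n + 1) ≤ M * u n) → ∀ n i, u (n + i) ≤ M ^ i * u n := by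
    intro u hu n i
    induction i with
    | zero => simp
    | succ i ih =>
      calc u (n + i + 1) ≤ M * u (n + i) := hu _
        _ ≤ M * (M ^ i * u n) := by gcongr
        _ = M ^ (i + 1) * u n := by ring
  have hdM := hstep d hd h
  rcases (hd 0).eq_or_lt with h0 | h0
  · refine ⟨1, one_pos, fun n => ?_⟩
    have := hpow d hdM 0 n
    rw [← h0] at this ⊢
    simp only [zero_add, mul_zero] at this
    simpa using le_antisymm this (hd n)
  have hpos : ∀ n, 0 < d n := by
    intro n
    induction n with
    | zero => exact h0
    | succ n ih =>
      refine (hd _).lt_of_ne fun h1 => ?_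
      have hz : ∀ i, d (n + 1 + i) = 0 := fun i =>
        le_antisymm (by simpa [← h1] using hpow d hdM (n + 1) i) (hd _)
      have := h n
      simp only [hz, Finset.sum_const_zero, mul_zero] at this
      have := this.unique hasSum_zero
      have := mul_pos hp0 ih
      linarith
  have hbdd : BddBelow (Set.range fun n => d (n + 1) / d n) :=
    ⟨0, by rintro _ ⟨n, rfl⟩; exact div_nonneg (hd _) (hd _)⟩
  set c : ℝ := ⨅ n, d (n + 1) / d n with hc
  have hc0 : 0 ≤ c := Real.iInf_nonneg fun n => div_nonneg (hd _) (hd _)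
  have hcd : ∀ n, c * d n ≤ d (n + 1) := fun n => by
    rw [← le_div_iff₀ (hpos n)]; exact ciInf_le hbdd n
  have hcM : c ≤ M := by
    refine (ciInf_le hbdd 0).trans ?_
    rw [div_le_iff₀ h0]; exact hdM 0
  set B : ℕ → ℝ := fun j => ∑ i ∈ Finset.range (j - 1), ((i : ℝ) + 1) * M ^ (i + 1) with hB
  have hBsum : Summable fun j => p j * B j := by
    refine Summable.of_nonneg_of_le (fun j => mul_nonneg (hp j)
      (Finset.sum_nonneg fun i _ => by positivity)) (fun j => ?_) (hR (4 * M))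
    refine mul_le_mul_of_nonneg_left ?_ (hp j)
    have hj : (j : ℝ) ≤ 2 ^ j := by exact_mod_cast Nat.lt_two_pow_self.le
    calc B j ≤ ∑ i ∈ Finset.range (j - 1), (j : ℝ) * M ^ j := by
          refine Finset.sum_le_sum fun i hi => ?_
          have hi' := Finset.mem_range.1 hi
          have : (i : ℝ) + 1 ≤ j := by exact_mod_cast (by omega : i + 1 ≤ j)
          exact mul_le_mul this (pow_le_pow_right₀ hM1 (by omega)) (by positivity) (by positivity)
      _ = ((j - 1 : ℕ) : ℝ) * (j * M ^ j) := by simp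
      _ ≤ j * (j * M ^ j) := by
          gcongr; omega
      _ ≤ 2 ^ j * (2 ^ j * M ^ j) := by gcongr
      _ = (4 * M) ^ j := by rw [mul_pow, ← mul_assoc, ← mul_pow]; norm_num
  have hSsum : Summable fun j => p j * ∑ i ∈ Finset.range (j - 1), c ^ (i + 1) := by
    refine Summable.of_nonneg_of_le (fun j => mul_nonneg (hp j)
      (Finset.sum_nonneg fun i _ => by positivity)) (fun j => ?_) hBsum
    refine mul_le_mul_of_nonneg_left (Finset.sum_le_sum fun i _ => ?_) (hp j)
    have h1 : c ^ (i + 1) ≤ M ^ (i + 1) := pow_le_pow_left₀ hc0 hcM _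
    have h2 : (0 : ℝ) ≤ i * M ^ (i + 1) := by positivity
    linarith
  set S : ℝ := ∑' j, p j * ∑ i ∈ Finset.range (j - 1), c ^ (i + 1) with hS
  have hge : p 0 ≤ S := by
    refine le_of_forall_pos_le_add fun δ hδ => ?_
    set K : ℝ := ∑' j, p j * B j
    have hK : 0 ≤ K := tsum_nonneg fun j => mul_nonneg (hp j)
      (Finset.sum_nonneg fun i _ => by positivity)
    set ε : ℝ := δ / (K + 1) with hε
    have hεpos : 0 < ε := by positivity
    have hεK : ε * K ≤ δ := by
      rw [hε, div_mul_eq_mul_div, div_le_iff₀ (by positivity)]; nlinarith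
    obtain ⟨n, hn⟩ : ∃ n, d (n + 1) / d n < c + ε := exists_lt_of_ciInf_lt (by linarith)
    rw [div_lt_iff₀ (hpos n)] at hn
    set u : ℕ → ℝ := fun m => d (m + 1) - c * d m with hu
    have hu0 : ∀ m, 0 ≤ u m := fun m => sub_nonneg.2 (hcd m)
    have hus : ∀ m, HasSum (fun j => p j * ∑ i ∈ Finset.range (j - 1), u (m + 1 + i))
        (p 0 * u m) := by
      intro m
      have := (h (m + 1)).sub ((h m).mul_left c)
      refine this.of_eq (fun j => ?_) ?_
      · simp only [hu, Finset.sum_sub_distrib, ← Finset.mul_sum]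
        have : ∀ i, d (m + 1 + i + 1) = d (m + 1 + 1 + i) := fun i => by congr 1; ring
        simp only [this]; ring
      · simp only [hu]; ring
    have huM := hpow u (hstep u hu0 hus) n
    have hun : u n ≤ ε * d n := by simp only [hu]; nlinarith
    have hup : ∀ i, d (n + i) ≤ (c ^ i + ε * (i * M ^ i)) * d n := by
      intro i
      induction i with
      | zero => simp
      | succ i ih =>
        have e1 : d (n + (i + 1)) = u (n + i) + c * d (n + i) := by simp only [hu]; ring_nf
        have e2 : u (n + i) ≤ M ^ i * (ε * d n) :=
          (huM i).trans (mul_le_mul_of_nonneg_left hun (by positivity))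
        have e3 : c * d (n + i) ≤ c * ((c ^ i + ε * (i * M ^ i)) * d n) :=
          mul_le_mul_of_nonneg_left ih hc0
        have e4 : M ^ i ≤ M ^ (i + 1) := pow_le_pow_right₀ hM1 (by omega)
        have e5 : c * (i * M ^ i) ≤ M * (i * M ^ i) :=
          mul_le_mul_of_nonneg_right hcM (by positivity)
        have e6 : M ^ i * (ε * d n) ≤ M ^ (i + 1) * (ε * d n) :=
          mul_le_mul_of_nonneg_right e4 (mul_nonneg hεpos.le (hd n))
        have e7 : c * (i * M ^ i) * (ε * d n) ≤ M * (i * M ^ i) * (ε * d n) :=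
          mul_le_mul_of_nonneg_right e5 (mul_nonneg hεpos.le (hd n))
        push_cast
        rw [e1]
        calc u (n + i) + c * d (n + i)
            ≤ M ^ (i + 1) * (ε * d n) + (c ^ (i + 1) * d n + M * (i * M ^ i) * (ε * d n)) := by
              have : c * ((c ^ i + ε * (i * M ^ i)) * d n)
                = c ^ (i + 1) * d n + c * (i * M ^ i) * (ε * d n) := by ring
              linarith
          _ = _ := by ring
    have hle := hasSum_le (fun j => ?_) (h n)
      ((hSsum.hasSum.add (hBsum.hasSum.mul_left ε)).mul_right (d n))
    · have : p 0 ≤ S + ε * K := le_of_mul_le_mul_right hle (hpos n)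
      linarith
    · have : ∑ i ∈ Finset.range (j - 1), d (n + 1 + i)
          ≤ (∑ i ∈ Finset.range (j - 1), c ^ (i + 1) + ε * B j) * d n := by
        rw [hB, Finset.mul_sum, ← Finset.sum_add_distrib, Finset.sum_mul]
        refine Finset.sum_le_sum fun i _ => ?_
        have := hup (i + 1)
        push_cast at this
        rwa [show n + 1 + i = n + (i + 1) by ring]
      calc _ ≤ p j * ((∑ i ∈ Finset.range (j - 1), c ^ (i + 1) + ε * B j) * d n) :=
            mul_le_mul_of_nonneg_left this (hp j)
        _ = _ := by ring
  have hcpos : 0 < c := by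
    refine hc0.lt_of_ne fun h1 => ?_
    rw [hS, ← h1] at hge
    simp at hge
    linarith
  have hlow : ∀ n i, c ^ i * d n ≤ d (n + i) := by
    intro n i
    induction i with
    | zero => simp
    | succ i ih =>
      calc c ^ (i + 1) * d n = c * (c ^ i * d n) := by ring
        _ ≤ c * d (n + i) := by gcongr
        _ ≤ _ := hcd _
  refine ⟨c, hcpos, fun n => ?_⟩
  have hrec : ∀ n, d (n + 1) = c * d n := by
    intro n
    refine le_antisymm ?_ (hcd n)
    have hle := hasSum_le (fun j => ?_) (hSsum.hasSum.mul_right (d (n + 1))) ((h n).mul_left c)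
    · have h1 : p 0 * d (n + 1) ≤ S * d (n + 1) := mul_le_mul_of_nonneg_right hge (hd _)
      have : p 0 * d (n + 1) ≤ p 0 * (c * d n) := by
        calc _ ≤ _ := h1.trans hle
          _ = _ := by ring
      exact le_of_mul_le_mul_left this hp0
    · have : (∑ i ∈ Finset.range (j - 1), c ^ (i + 1)) * d (n + 1)
          ≤ c * ∑ i ∈ Finset.range (j - 1), d (n + 1 + i) := by
        rw [Finset.mul_sum, Finset.sum_mul]
        refine Finset.sum_le_sum fun i _ => ?_
        calc c ^ (i + 1) * d (n + 1) = c * (c ^ i * d (n + 1)) := by ring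
          _ ≤ _ := by gcongr; exact hlow _ _
      calc _ = p j * ((∑ i ∈ Finset.range (j - 1), c ^ (i + 1)) * d (n + 1)) := by ring
        _ ≤ p j * (c * ∑ i ∈ Finset.range (j - 1), d (n + 1 + i)) :=
            mul_le_mul_of_nonneg_left this (hp j)
        _ = _ := by ring
  induction n with
  | zero => simp
  | succ n ih => rw [hrec, ih]; ring

/-- Nonnegative harmonic functions of a skip-free walk on `ℕ` with nonpositive drift. -/
theorem skipFree_harmonic_form {p F : ℕ → ℝ} (hp : ∀ j, 0 ≤ p j) (hp0 : 0 < p 0)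
    (hsum : HasSum p 1) (hdrift : ∑' j : ℕ, p j * j ≤ 1)
    (hR : ∀ R : ℝ, Summable fun j => p j * R ^ j) (h2 : ∃ j, 2 ≤ j ∧ 0 < p j)
    (hF : ∀ y, 0 ≤ F y) (hharm : ∀ y, HasSum (fun j => p j * F (y + j)) (F (y + 1))) :
    ∃ c : ℝ, 0 < c ∧ ∃ B : ℝ, 0 ≤ B ∧ (∀ y, F y = F 0 + B * ∑ i ∈ Finset.range y, c ^ i) ∧
      (B = 0 ∨ (c = 1 ∧ ∑' j : ℕ, p j * j = 1) ∨ (c ≠ 1 ∧ HasSum (fun j => p j * c ^ j) c)) := by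
  have hmean : Summable fun j : ℕ => p j * j := by
    refine Summable.of_nonneg_of_le (fun j => mul_nonneg (hp j) (by positivity))
      (fun j => mul_le_mul_of_nonneg_left ?_ (hp j)) (hR 2)
    exact_mod_cast Nat.lt_two_pow_self.le
  have hmono : ∀ n, F n ≤ F (n + 1) := fun n =>
    skipFree_minimum_principle (F := fun y => F (n + y)) hp hp0 hsum hmean hdrift
      (fun y => hF _) (fun y => by simpa [add_assoc] using hharm (n + y)) 1
  obtain ⟨c, hc, hcn⟩ := geometric_of_renewal (d := fun n => F (n + 1) - F n) hp hp0 hR h2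
    (fun n => sub_nonneg.2 (hmono n)) (fun n => by
      have h1 := ((hharm n).sub (hsum.mul_right (F (n + 1)))).add
        (hasSum_ite_eq 0 (p 0 * (F (n + 1) - F n)))
      refine h1.of_eq (fun j => ?_) ?_
      · rcases j with _ | j
        · simp; ring
        · have := Finset.sum_range_sub (fun i => F (n + 1 + i)) j
          simp only [Nat.add_sub_cancel, add_eq_zero, one_ne_zero, and_false, if_false, add_zero]
          simp only [add_assoc] at this ⊢
          rw [this]
          simp only [add_zero]
          rw [show 1 + j = j + 1 by ring]; ring
      · ring)
  have hform : ∀ y, F y = F 0 + (F 1 - F 0) * ∑ i ∈ Finset.range y, c ^ i := by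
    intro y
    rw [Finset.mul_sum, ← Finset.sum_congr rfl (fun i _ => hcn i), Finset.sum_range_sub]
    ring
  refine ⟨c, hc, F 1 - F 0, sub_nonneg.2 (hmono 0), hform, ?_⟩
  by_cases hB : F 1 - F 0 = 0
  · exact Or.inl hB
  right
  have hG : HasSum (fun j => p j * ∑ i ∈ Finset.range j, c ^ i) 1 := by
    have h1 := ((hharm 0).sub (hsum.mul_right (F 0))).div_const (F 1 - F 0)
    refine h1.of_eq (fun j => ?_) ?_
    · rw [zero_add, hform j, eq_div_iff hB]; ring
    · rw [zero_add, eq_div_iff hB]; ring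
  by_cases hc1 : c = 1
  · left
    refine ⟨hc1, ?_⟩
    rw [← hG.tsum_eq]
    simp [hc1]
  · right
    refine ⟨hc1, ?_⟩
    have h1 := (hG.mul_right (c - 1)).add hsum
    refine h1.of_eq (fun j => ?_) ?_
    · rw [mul_assoc, geom_sum_mul]; ring
    · ring

/-- A positive harmonic function for nonnegative weights forces a subcritical exponential. -/
theorem exists_subcritical_of_harmonic {p F : ℕ → ℝ} (hp : ∀ j, 0 ≤ p j) (hp0 : 0 < p 0)
    (h2 : ∃ j, 2 ≤ j ∧ 0 < p j)
    (hF : ∀ y, 0 < F y) (hharm : ∀ y, HasSum (fun j => p j * F (y + j)) (F (y + 1))) :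
    ∃ c : ℝ, 0 < c ∧ ∑' j, p j * c ^ j ≤ c := by
  obtain ⟨J, hJ2, hJ⟩ := h2
  have hterm : ∀ y j, p j * F (y + j) ≤ F (y + 1) := fun y j =>
    le_hasSum (hharm y) j fun i _ => mul_nonneg (hp i) (hF _).le
  have hlow : ∀ y i, p 0 ^ i * F y ≤ F (y + i) := by
    intro y i
    induction i with
    | zero => simp
    | succ i ih =>
      calc p 0 ^ (i + 1) * F y = p 0 * (p 0 ^ i * F y) := by ring
        _ ≤ p 0 * F (y + i) := by gcongr
        _ ≤ _ := hterm (y + i) 0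
  set A : Set ℝ := {c | ∃ N, ∀ y, N ≤ y → c * F y ≤ F (y + 1)} with hA
  have hpA : p 0 ∈ A := ⟨0, fun y _ => hterm y 0⟩
  have hup : ∀ y, F (y + 2) ≤ (p J * p 0 ^ (J - 2))⁻¹ * F (y + 1) := by
    intro y
    rw [← div_eq_inv_mul, le_div_iff₀ (by positivity)]
    have h1 := hlow (y + 2) (J - 2)
    rw [show y + 2 + (J - 2) = y + J by omega] at h1
    have h3 := hterm y J
    have h4 := mul_le_mul_of_nonneg_left h1 hJ.le
    linarith
  have hAbdd : BddAbove A := by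
    refine ⟨(p J * p 0 ^ (J - 2))⁻¹, ?_⟩
    rintro c ⟨N, hN⟩
    exact le_of_mul_le_mul_right ((hN (N + 1) (by omega)).trans (hup N)) (hF _)
  set c : ℝ := sSup A with hc
  have hcpos : 0 < c := hp0.trans_le (le_csSup hAbdd hpA)
  refine ⟨c, hcpos, ?_⟩
  have key : ∀ ε : ℝ, 0 < ε → ε < c → ∀ s : Finset ℕ, ∑ j ∈ s, p j * (c - ε) ^ j ≤ c + ε := by
    intro ε hε hεc s
    obtain ⟨b, ⟨N, hN⟩, hb⟩ := exists_lt_of_lt_csSup ⟨_, hpA⟩ (show c - ε < sSup A by linarith)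
    have hN' : ∀ y, N ≤ y → (c - ε) * F y ≤ F (y + 1) := fun y hy =>
      (mul_le_mul_of_nonneg_right hb.le (hF y).le).trans (hN y hy)
    have hnot : c + ε ∉ A := fun hmem => by have := le_csSup hAbdd hmem; linarith
    have hex : ∃ y, N + 1 ≤ y ∧ F (y + 1) < (c + ε) * F y := by
      by_contra! hcon
      exact hnot ⟨N + 1, hcon⟩
    obtain ⟨y, hy, hlt⟩ := hex
    obtain ⟨k, rfl⟩ : ∃ k, y = k + 1 := ⟨y - 1, by omega⟩
    have hk : N ≤ k := by omega
    have hu : p 0 * (F (k + 1) - (c - ε) * F k) ≤ 2 * ε * F (k + 1) := by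
      have hs := (hharm (k + 1)).sub ((hharm k).mul_left (c - ε))
      have h1 := le_hasSum hs 0 fun j _ => by
        have := mul_le_mul_of_nonneg_left (hN' (k + j) (by omega)) (hp j)
        rw [show k + 1 + j = k + j + 1 by ring]
        linarith
      simp only [add_zero] at h1
      linarith
    have hpw : ∀ i, (c - ε) ^ i * F (k + 1) ≤ F (k + 1 + i) := by
      intro i
      induction i with
      | zero => simp
      | succ i ih =>
        have h0 : 0 ≤ c - ε := by linarith
        calc (c - ε) ^ (i + 1) * F (k + 1) = (c - ε) * ((c - ε) ^ i * F (k + 1)) := by ring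
          _ ≤ (c - ε) * F (k + 1 + i) := by gcongr
          _ ≤ _ := hN' _ (by omega)
    have hs := ((hharm k).mul_left (c - ε)).add (hasSum_ite_eq 0 (2 * ε * F (k + 1)))
    have hfin : ∑ j ∈ s, p j * (c - ε) ^ j * F (k + 1)
        ≤ (c - ε) * F (k + 1) + 2 * ε * F (k + 1) := by
      refine le_trans (Finset.sum_le_sum fun j _ => ?_) (sum_le_hasSum s (fun j _ => ?_) hs)
      · rcases j with _ | j
        · simp; linarith
        · have := mul_le_mul_of_nonneg_left (hpw j) (mul_nonneg (hp (j + 1)) (by linarith : 0 ≤ c - ε))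
          simp only [add_eq_zero, one_ne_zero, and_false, if_false, add_zero]
          rw [show k + 1 + j = k + (j + 1) by ring] at this
          calc _ = p (j + 1) * (c - ε) * ((c - ε) ^ j * F (k + 1)) := by ring
            _ ≤ _ := this
            _ = _ := by ring
      · have : 0 ≤ (c - ε) * (p j * F (k + j)) :=
          mul_nonneg (by linarith) (mul_nonneg (hp j) (hF _).le)
        have h3 : 0 ≤ 2 * ε * F (k + 1) := by have := hF (k + 1); positivity
        split_ifs <;> linarith
    rw [← Finset.sum_mul] at hfin
    exact le_of_mul_le_mul_right (by linarith) (hF (k + 1))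
  refine Real.tsum_le_of_sum_le (fun j => by have := hp j; positivity) fun s => ?_
  have h1 : Tendsto (fun ε : ℝ => ∑ j ∈ s, p j * (c - ε) ^ j) (nhdsWithin 0 (Set.Ioi 0))
      (nhds (∑ j ∈ s, p j * (c - 0) ^ j)) :=
    (Continuous.tendsto (by fun_prop) 0).mono_left nhdsWithin_le_nhds
  have h3 : Tendsto (fun ε : ℝ => c + ε) (nhdsWithin 0 (Set.Ioi 0)) (nhds (c + 0)) :=
    (Continuous.tendsto (by fun_prop) 0).mono_left nhdsWithin_le_nhds
  rw [sub_zero] at h1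
  rw [add_zero] at h3
  refine le_of_tendsto_of_tendsto h1 h3 ?_
  filter_upwards [Ioo_mem_nhdsGT hcpos] with ε hε using key ε hε.1 hε.2 s

/-! ### Exponential moments -/

/-- The `ℓ¹` norm on `ℤ^d`. -/
noncomputable def l1 {d : ℕ} (w : Zd d) : ℝ := ∑ i, |(w.1 i : ℝ)| + |(w.2 : ℝ)|

theorem l1_nonneg {d : ℕ} (w : Zd d) : 0 ≤ l1 w := by unfold l1; positivity

theorem l1_add_le {d : ℕ} (v w : Zd d) : l1 (v + w) ≤ l1 v + l1 w := by
  unfold l1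
  have h1 : ∑ i, |((v + w).1 i : ℝ)| ≤ ∑ i, |(v.1 i : ℝ)| + ∑ i, |(w.1 i : ℝ)| := by
    rw [← Finset.sum_add_distrib]
    exact Finset.sum_le_sum fun i _ => by simpa using abs_add_le (v.1 i : ℝ) (w.1 i)
  have h2 : |((v + w).2 : ℝ)| ≤ |(v.2 : ℝ)| + |(w.2 : ℝ)| := by
    simpa using abs_add_le (v.2 : ℝ) w.2
  linarith

theorem abs_dotZ_le {d : ℕ} (a : Rd d) (w : Zd d) : |dotZ d a w| ≤ ‖a‖ * l1 w := by
  unfold dotZ l1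
  rw [mul_add, Finset.mul_sum]
  refine (abs_add_le _ _).trans (add_le_add ((Finset.abs_sum_le_sum_abs _ _).trans
    (Finset.sum_le_sum fun i _ => ?_)) ?_)
  · rw [abs_mul]
    exact mul_le_mul_of_nonneg_right ((norm_le_pi_norm a.1 i).trans (norm_fst_le a)) (abs_nonneg _)
  · rw [abs_mul]
    exact mul_le_mul_of_nonneg_right (norm_snd_le a) (abs_nonneg _)

theorem dotZ_add_right {d : ℕ} (a : Rd d) (v w : Zd d) :
    dotZ d a (v + w) = dotZ d a v + dotZ d a w := by
  simp only [dotZ, Prod.fst_add, Prod.snd_add, Pi.add_apply, Int.cast_add, mul_add,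
    Finset.sum_add_distrib]
  ring

theorem summable_exp_l1 {d : ℕ} {μ : Zd d → ℝ} (hμ : ∀ z, 0 ≤ μ z)
    (h : ∀ a, Summable fun z => μ z * Real.exp (dotZ d a z)) (κ : ℝ) :
    Summable fun z => μ z * Real.exp (κ * l1 z) := by
  set a : ((Fin (d - 1) → Bool) × Bool) → Rd d := fun ε =>
    (fun i => if ε.1 i then κ else -κ, if ε.2 then κ else -κ) with ha
  refine Summable.of_nonneg_of_le (fun z => mul_nonneg (hμ z) (Real.exp_pos _).le) (fun z => ?_)
    (summable_sum (s := Finset.univ) fun ε _ => h (a ε))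
  rw [← Finset.mul_sum]
  refine mul_le_mul_of_nonneg_left ?_ (hμ z)
  refine le_trans (le_of_eq ?_) (Finset.single_le_sum
    (f := fun ε => Real.exp (dotZ d (a ε) z)) (fun ε _ => (Real.exp_pos _).le)
    (Finset.mem_univ (fun i => decide (0 ≤ z.1 i), decide (0 ≤ z.2))))
  have hs : ∀ t : ℤ, (if decide (0 ≤ t) then κ else -κ) * (t : ℝ) = κ * |(t : ℝ)| := by
    intro t
    by_cases ht : 0 ≤ t
    · have : (0 : ℝ) ≤ t := by exact_mod_cast ht
      simp [ht, abs_of_nonneg this]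
    · have : (t : ℝ) < 0 := by exact_mod_cast not_le.1 ht
      simp [ht, abs_of_neg this]
  simp only [dotZ, ha, l1, hs, mul_add, Finset.mul_sum]

theorem summable_weighted {d : ℕ} {μ : Zd d → ℝ} (hμ : ∀ z, 0 ≤ μ z)
    (h : ∀ a, Summable fun z => μ z * Real.exp (dotZ d a z)) {g : Zd d → ℝ} {κ C : ℝ}
    (hg : ∀ w, |g w| ≤ C * Real.exp (κ * l1 w)) : Summable fun z => μ z * g z := by
  refine Summable.of_norm_bounded ((summable_exp_l1 hμ h κ).mul_left C) fun z => ?_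
  rw [Real.norm_eq_abs, abs_mul, abs_of_nonneg (hμ z)]
  calc _ ≤ μ z * (C * Real.exp (κ * l1 z)) := mul_le_mul_of_nonneg_left (hg z) (hμ z)
    _ = _ := by ring

theorem continuous_weighted {d : ℕ} {μ : Zd d → ℝ} (hμ : ∀ z, 0 ≤ μ z)
    (h : ∀ a, Summable fun z => μ z * Real.exp (dotZ d a z)) {g : Zd d → ℝ}
    (hg : ∀ w, |g w| ≤ Real.exp (l1 w)) :
    Continuous fun a => ∑' z, μ z * g z * Real.exp (dotZ d a z) := by
  rw [continuous_iff_continuousAt]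
  intro a₀
  have hon : ContinuousOn (fun a => ∑' z, μ z * g z * Real.exp (dotZ d a z))
      (Metric.ball a₀ 1) := by
    refine continuousOn_tsum (fun z => ?_) (summable_exp_l1 hμ h (‖a₀‖ + 2)) fun z a ha => ?_
    · unfold dotZ; fun_prop
    · rw [norm_mul, norm_mul, Real.norm_eq_abs, Real.norm_eq_abs, Real.norm_eq_abs, Real.abs_exp,
        abs_of_nonneg (hμ z), mul_assoc]
      refine mul_le_mul_of_nonneg_left ?_ (hμ z)
      have h1 : ‖a‖ ≤ ‖a₀‖ + 1 := by
        have := norm_sub_norm_le a a₀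
        rw [Metric.mem_ball, dist_eq_norm] at ha
        linarith
      have h2 := (le_abs_self _).trans (abs_dotZ_le a z)
      have h3 := mul_le_mul_of_nonneg_right h1 (l1_nonneg z)
      calc _ ≤ Real.exp (l1 z) * Real.exp ((‖a₀‖ + 1) * l1 z) :=
            mul_le_mul (hg z) (Real.exp_le_exp.2 (h2.trans h3)) (Real.exp_pos _).le
              (Real.exp_pos _).le
        _ = _ := by rw [← Real.exp_add]; ring_nf
  exact hon.continuousAt (Metric.ball_mem_nhds _ one_pos)

theorem abs_snd_le_exp_l1 {d : ℕ} (w : Zd d) : |(w.2 : ℝ)| ≤ Real.exp (l1 w) := by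
  have h1 : |(w.2 : ℝ)| ≤ l1 w := le_add_of_nonneg_left (Finset.sum_nonneg fun i _ => abs_nonneg _)
  have := Real.add_one_le_exp (l1 w)
  linarith

theorem continuous_jgf {d : ℕ} {μ : Zd d → ℝ} (hμ : ∀ z, 0 ≤ μ z)
    (h : ∀ a, Summable fun z => μ z * Real.exp (dotZ d a z)) : Continuous (jgf d μ) := by
  have := continuous_weighted hμ h (g := fun _ => 1)
    fun w => by simpa using Real.one_le_exp (l1_nonneg w)
  simp only [mul_one] at this
  exact this

theorem continuous_jgfDβ {d : ℕ} {μ : Zd d → ℝ} (hμ : ∀ z, 0 ≤ μ z)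
    (h : ∀ a, Summable fun z => μ z * Real.exp (dotZ d a z)) : Continuous (jgfDβ d μ) :=
  continuous_weighted hμ h abs_snd_le_exp_l1

theorem summable_jgfDβ {d : ℕ} {μ : Zd d → ℝ} (hμ : ∀ z, 0 ≤ μ z)
    (h : ∀ a, Summable fun z => μ z * Real.exp (dotZ d a z)) (a : Rd d) :
    Summable fun z => μ z * (z.2 : ℝ) * Real.exp (dotZ d a z) := by
  simp only [mul_assoc]
  refine summable_weighted hμ h (κ := ‖a‖ + 1) (C := 1) fun w => ?_
  rw [abs_mul, Real.abs_exp, one_mul]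
  calc _ ≤ Real.exp (l1 w) * Real.exp (‖a‖ * l1 w) :=
        mul_le_mul (abs_snd_le_exp_l1 w) (Real.exp_le_exp.2 ((le_abs_self _).trans
          (abs_dotZ_le a w))) (Real.exp_pos _).le (Real.exp_pos _).le
    _ = _ := by rw [← Real.exp_add]; ring_nf

/-! ### Iterated kernels -/

theorem kerIter_rel {S : Type*} [DecidableEq S] {p : S → S → ℝ≥0∞} {R : ℕ → S → S → Prop}
    (hrefl : ∀ z, R 0 z z) (hstep : ∀ n z w w', R n z w → p w w' ≠ 0 → R (n + 1) z w') :
    ∀ n z w, kerIter p n z w ≠ 0 → R n z w := by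
  intro n z
  induction n with
  | zero =>
    intro w hw
    have : z = w := by by_contra hne; simp [kerIter, hne] at hw
    exact this ▸ hrefl z
  | succ n ih =>
    intro w hw
    simp only [kerIter, ne_eq, ENNReal.tsum_eq_zero, not_forall, mul_eq_zero, not_or] at hw
    obtain ⟨v, hv1, hv2⟩ := hw
    exact hstep n z v w (ih v hv1) hv2

theorem tsum_kerIter_mul_le {S : Type*} [DecidableEq S] {p : S → S → ℝ≥0∞} {H : S → ℝ≥0∞} {z : S}
    (n : ℕ) (hH : ∀ k < n, ∀ w, kerIter p k z w ≠ 0 → ∑' w', p w w' * H w' ≤ H w) :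
    ∑' w, kerIter p n z w * H w ≤ H z := by
  induction n with
  | zero =>
    rw [tsum_eq_single z (fun w hw => by simp [kerIter, hw.symm])]
    simp [kerIter]
  | succ n ih =>
    refine le_trans ?_ (ih fun k hk => hH k (by omega))
    calc ∑' w, kerIter p (n + 1) z w * H w
        = ∑' w, ∑' v, kerIter p n z v * (p v w * H w) := by
          simp only [kerIter, ← ENNReal.tsum_mul_right, mul_assoc]
      _ = ∑' v, kerIter p n z v * ∑' w, p v w * H w := by
          rw [ENNReal.tsum_comm]; simp only [ENNReal.tsum_mul_left]
      _ ≤ _ := by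
          refine ENNReal.tsum_le_tsum fun v => ?_
          by_cases hv : kerIter p n z v = 0
          · simp [hv]
          · gcongr; exact hH n (by omega) v hv

theorem kerIter_mul_le {S : Type*} [DecidableEq S] {p : S → S → ℝ≥0∞} {H : S → ℝ≥0∞}
    (hH : ∀ w, ∑' w', p w w' * H w' ≤ H w) (n : ℕ) (z w : S) : kerIter p n z w * H w ≤ H z :=
  (ENNReal.le_tsum w).trans (tsum_kerIter_mul_le n fun _ _ w _ => hH w)

theorem exists_pos_ofReal_le {q : ℝ≥0∞} (hq : 0 < q) : ∃ r : ℝ, 0 < r ∧ ENNReal.ofReal r ≤ q := by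
  by_cases h : q = ⊤
  · exact ⟨1, one_pos, by simp [h]⟩
  · exact ⟨q.toReal, ENNReal.toReal_pos hq.ne' h, ENNReal.ofReal_toReal_le⟩

/-! ### The transition kernel -/

theorem toZ_add {d : ℕ} (z v : St d) : toZ d (z + v) = toZ d z + toZ d v := by
  simp [toZ]

theorem toZ_injective {d : ℕ} : Function.Injective (toZ d) := by
  rintro ⟨x, y⟩ ⟨x', y'⟩ h
  simpa [toZ, Prod.ext_iff] using h

theorem exists_toZ_eq {d : ℕ} {v : Zd d} (hv : 0 ≤ v.2) : ∃ z, toZ d z = v :=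
  ⟨(v.1, v.2.toNat), by simp [toZ, hv]⟩

/-- The jump law at the state `z`. -/
noncomputable def jump {d : ℕ} (μ μ0 : Zd d → ℝ) (z : St d) : Zd d → ℝ :=
  if z.2 = 0 then μ0 else μ

theorem stepR_eq {d : ℕ} (μ μ0 : Zd d → ℝ) (z z' : St d) :
    stepR d μ μ0 z z' = jump μ μ0 z (toZ d z' - toZ d z) := by
  unfold stepR jump; split_ifs <;> rfl

theorem step_eq {d : ℕ} (μ μ0 : Zd d → ℝ) (z z' : St d) :
    step d μ μ0 z z' = ENNReal.ofReal (stepR d μ μ0 z z') := by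
  unfold step stepR; split_ifs <;> rfl

theorem hasSum_stepR {d : ℕ} {μ μ0 : Zd d → ℝ} (hH0 : H0 d μ μ0) (z : St d) (g : Zd d → ℝ)
    (b : ℝ) : HasSum (fun z' => stepR d μ μ0 z z' * g (toZ d z')) b ↔
      HasSum (fun w => jump μ μ0 z w * g (toZ d z + w)) b := by
  have hinj : Function.Injective fun z' : St d => toZ d z' - toZ d z :=
    fun a b h => toZ_injective (sub_left_inj.1 h)
  rw [← hinj.hasSum_iff]
  · refine iff_of_eq (congrArg (fun f => HasSum f b) (funext fun z' => ?_))
    simp [stepR_eq]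
  · intro w hw
    have hneg : (toZ d z + w).2 < 0 := by
      by_contra! hcon
      obtain ⟨z', hz'⟩ := exists_toZ_eq hcon
      exact hw ⟨z', by simp [hz']⟩
    have h2 : (z.2 : ℤ) + w.2 < 0 := hneg
    have : jump μ μ0 z w = 0 := by
      unfold jump
      split_ifs with h0
      · exact hH0.2 w (by omega)
      · exact hH0.1 w (by omega)
    simp [this]

/-- Extension by zero of a function on the half-space. -/
noncomputable def extZ {d : ℕ} (h : St d → ℝ) (v : Zd d) : ℝ :=
  if 0 ≤ v.2 then h (v.1, v.2.toNat) else 0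

theorem extZ_toZ {d : ℕ} (h : St d → ℝ) (z : St d) : extZ h (toZ d z) = h z := by
  simp [extZ, toZ]

theorem extZ_nonneg {d : ℕ} {h : St d → ℝ} (hh : ∀ z, 0 ≤ h z) (v : Zd d) : 0 ≤ extZ h v := by
  unfold extZ; split_ifs <;> simp [hh]

theorem isHarmonic_iff_jump {d : ℕ} {μ μ0 : Zd d → ℝ} (hH0 : H0 d μ μ0) {h : St d → ℝ} :
    IsHarmonic d μ μ0 h ↔
      ∀ z, HasSum (fun w => jump μ μ0 z w * extZ h (toZ d z + w)) (h z) := by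
  refine forall_congr' fun z => ?_
  rw [← hasSum_stepR hH0]
  simp only [extZ_toZ]

theorem jump_nonneg {d : ℕ} {μ μ0 : Zd d → ℝ} (hμ : IsProb d μ) (hμ0 : IsProb d μ0) (z : St d)
    (w : Zd d) : 0 ≤ jump μ μ0 z w := by
  unfold jump; split_ifs
  · exact hμ0.1 w
  · exact hμ.1 w

theorem stepR_nonneg {d : ℕ} {μ μ0 : Zd d → ℝ} (hμ : IsProb d μ) (hμ0 : IsProb d μ0) (z z' : St d) :
    0 ≤ stepR d μ μ0 z z' := by
  rw [stepR_eq]; exact jump_nonneg hμ hμ0 _ _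

theorem tsum_step_ofReal {d : ℕ} {μ μ0 : Zd d → ℝ} (hμ : IsProb d μ) (hμ0 : IsProb d μ0)
    {h : St d → ℝ} (hh : ∀ z, 0 ≤ h z) (hharm : IsHarmonic d μ μ0 h) (z : St d) :
    ∑' z', step d μ μ0 z z' * ENNReal.ofReal (h z') = ENNReal.ofReal (h z) := by
  rw [← (hharm z).tsum_eq, ENNReal.ofReal_tsum_of_nonneg
    (fun z' => mul_nonneg (stepR_nonneg hμ hμ0 z z') (hh z')) (hharm z).summable]
  exact tsum_congr fun z' => by rw [step_eq, ENNReal.ofReal_mul (stepR_nonneg hμ hμ0 z z')]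

theorem isHarmonic_toReal {d : ℕ} {μ μ0 : Zd d → ℝ} (hμ : IsProb d μ) (hμ0 : IsProb d μ0)
    {H : St d → ℝ≥0∞} (hfin : ∀ z, H z ≠ ⊤)
    (hharm : ∀ z, ∑' z', step d μ μ0 z z' * H z' = H z) :
    IsHarmonic d μ μ0 fun z => (H z).toReal := by
  intro z
  have hne : ∑' z', step d μ μ0 z z' * H z' ≠ ⊤ := by rw [hharm]; exact hfin z
  have := ENNReal.hasSum_toReal hne
  rw [← ENNReal.tsum_toReal_eq (fun z' => ENNReal.ne_top_of_tsum_ne_top hne z'), hharm] at this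
  simpa [step_eq, ENNReal.toReal_ofReal (stepR_nonneg hμ hμ0 _ _)] using this

theorem IsHarmonic.shift {d : ℕ} {μ μ0 : Zd d → ℝ} {h : St d → ℝ} (hharm : IsHarmonic d μ μ0 h)
    (x : Fin (d - 1) → ℤ) : IsHarmonic d μ μ0 fun z => h (z + (x, 0)) := by
  intro z
  have h1 := hharm (z + (x, 0))
  have hinj : Function.Bijective fun z' : St d => z' + ((x, 0) : St d) := by
    refine ⟨fun a b hab => by simpa using hab, fun b => ⟨(b.1 - x, b.2), by simp⟩⟩
  rw [← (Equiv.ofBijective _ hinj).hasSum_iff] at h1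
  refine h1.of_eq (fun z' => ?_) rfl
  simp [stepR, toZ_add]

/-- Uniform Harnack inequality along translations. -/
theorem harnack_shift {d : ℕ} {μ μ0 : Zd d → ℝ} (hμ : IsProb d μ) (hμ0 : IsProb d μ0)
    (hH0 : H0 d μ μ0) (hH1 : H1 d μ μ0) (hH2 : H2 d μ) (v : St d) :
    ∃ C : ℝ, 0 < C ∧ ∀ h : St d → ℝ, (∀ z, 0 ≤ h z) → IsHarmonic d μ μ0 h →
      ∀ z, h (z + v) ≤ C * h z := by
  obtain ⟨n, hn⟩ := hH2.1 0 (toZ d v)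
  obtain ⟨r, hr, hrn⟩ := exists_pos_ofReal_le hn
  have hbulk : ∀ h : St d → ℝ, (∀ z, 0 ≤ h z) → IsHarmonic d μ μ0 h →
      ∀ z : St d, n ≤ z.2 → h (z + v) ≤ r⁻¹ * h z := by
    intro h hh hharm z hz
    set H : Zd d → ℝ≥0∞ := fun w => ENNReal.ofReal (extZ h (toZ d z + w)) with hH
    have key : ∑' w, stepSn d μ n 0 w * H w ≤ H 0 := by
      refine tsum_kerIter_mul_le n fun k hk w hw => ?_
      have hw2 : -(k : ℤ) ≤ w.2 := by
        have := kerIter_rel (p := stepS d μ) (R := fun n z w => z.2 - (n : ℤ) ≤ w.2)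
          (fun z => by simp) (fun n z w w' h1 h2 => by
            have : ¬ (w' - w).2 < -1 := fun hlt => h2 (by simp [stepS, hH0.1 _ hlt])
            simp only [Prod.snd_sub] at this
            push_cast; omega) k 0 w hw
        simpa using this
      have hpos : 0 ≤ (toZ d z + w).2 := by
        change 0 ≤ (z.2 : ℤ) + w.2
        omega
      obtain ⟨z₁, hz₁⟩ := exists_toZ_eq hpos
      have hz₁0 : z₁.2 ≠ 0 := by
        intro h0
        have : (z₁.2 : ℤ) = (z.2 : ℤ) + w.2 := congrArg Prod.snd hz₁
        omega
      have h1 := (isHarmonic_iff_jump hH0).1 hharm z₁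
      have hj : jump μ μ0 z₁ = μ := by simp [jump, hz₁0]
      rw [hj] at h1
      have hz₁e : extZ h (toZ d z + w) = h z₁ := by rw [← hz₁, extZ_toZ]
      simp only [hH, hz₁e]
      rw [← h1.tsum_eq, ENNReal.ofReal_tsum_of_nonneg
        (fun w' => mul_nonneg (hμ.1 w') (extZ_nonneg hh _)) h1.summable,
        ← (Equiv.addLeft w).tsum_eq]
      refine le_of_eq (tsum_congr fun u => ?_)
      simp only [stepS, Equiv.coe_addLeft, add_sub_cancel_left, hz₁, add_assoc]
      rw [ENNReal.ofReal_mul (hμ.1 u)]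
    have h1 : ENNReal.ofReal r * ENNReal.ofReal (h (z + v)) ≤ ENNReal.ofReal (h z) := by
      have h2 := (ENNReal.le_tsum (toZ d v)).trans key
      simp only [hH, ← toZ_add, extZ_toZ, add_zero] at h2
      exact (mul_le_mul_left hrn _).trans h2
    rw [← ENNReal.ofReal_mul hr.le, ENNReal.ofReal_le_ofReal_iff (hh z)] at h1
    rwa [← div_eq_inv_mul, le_div_iff₀ hr, mul_comm]
  have hlayer : ∀ y : ℕ, ∃ C : ℝ, 0 < C ∧ ∀ h : St d → ℝ, (∀ z, 0 ≤ h z) → IsHarmonic d μ μ0 h →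
      ∀ x, h ((x, y) + v) ≤ C * h (x, y) := by
    intro y
    obtain ⟨k, hk⟩ := hH1 (0, y) ((0, y) + v)
    obtain ⟨s, hs, hsk⟩ := exists_pos_ofReal_le hk
    refine ⟨s⁻¹, by positivity, fun h hh hharm x => ?_⟩
    have h1 := kerIter_mul_le (H := fun z => ENNReal.ofReal (h (z + (x, 0))))
      (fun z => (tsum_step_ofReal hμ hμ0 (fun z => hh _) (hharm.shift x) z).le) k (0, y) ((0, y) + v)
    have h2 := (mul_le_mul_left hsk _).trans h1
    rw [← ENNReal.ofReal_mul hs.le, ENNReal.ofReal_le_ofReal_iff (hh _)] at h2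
    have e1 : ((0, y) : St d) + (x, 0) = (x, y) := by simp
    have e2 : ((0, y) : St d) + v + (x, 0) = (x, y) + v := by rw [add_right_comm, e1]
    rw [e1, e2] at h2
    rwa [← div_eq_inv_mul, le_div_iff₀ hs, mul_comm]
  choose C hC hCh using hlayer
  refine ⟨r⁻¹ + ∑ y ∈ Finset.range n, C y, add_pos_of_pos_of_nonneg (by positivity)
    (Finset.sum_nonneg fun y _ => (hC y).le), fun h hh hharm z => ?_⟩
  by_cases hz : n ≤ z.2
  · refine (hbulk h hh hharm z hz).trans (mul_le_mul_of_nonneg_right ?_ (hh z))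
    exact le_add_of_nonneg_right (Finset.sum_nonneg fun y _ => (hC y).le)
  · refine (hCh z.2 h hh hharm z.1).trans (mul_le_mul_of_nonneg_right ?_ (hh z))
    have := Finset.single_le_sum (f := C) (fun y _ => (hC y).le)
      (Finset.mem_range.2 (not_le.1 hz))
    have : 0 < r⁻¹ := by positivity
    linarith

theorem IsHarmonic.pos {d : ℕ} {μ μ0 : Zd d → ℝ} (hμ : IsProb d μ) (hμ0 : IsProb d μ0)
    (hH1 : H1 d μ μ0) {h : St d → ℝ} (hh : ∀ z, 0 ≤ h z) (hharm : IsHarmonic d μ μ0 h)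
    {w : St d} (hw : 0 < h w) (z : St d) : 0 < h z := by
  obtain ⟨k, hk⟩ := hH1 z w
  have h1 := kerIter_mul_le (H := fun z => ENNReal.ofReal (h z))
    (fun z => (tsum_step_ofReal hμ hμ0 hh hharm z).le) k z w
  have : 0 < ENNReal.ofReal (h z) :=
    lt_of_lt_of_le (ENNReal.mul_pos hk.ne' (ENNReal.ofReal_pos.2 hw).ne') h1
  exact ENNReal.ofReal_pos.1 this

theorem exists_down_step {d : ℕ} {μ μ0 : Zd d → ℝ} (hH0 : H0 d μ μ0)
    (hH2 : H2 d μ) : ∃ w : Zd d, w.2 = -1 ∧ 0 < μ w := by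
  by_contra! hcon
  obtain ⟨n, hn⟩ := hH2.1 0 (0, -1)
  have := kerIter_rel (p := stepS d μ) (R := fun _ z w => z.2 ≤ w.2)
    (fun z => le_rfl) (fun _ z w w' h1 h2 => h1.trans (by
      by_contra! hlt
      refine h2 ?_
      rcases eq_or_ne (w' - w).2 (-1) with h | h
      · simp [stepS, hcon _ h]
      · have : (w' - w).2 < -1 := by simp only [Prod.snd_sub] at h ⊢; omega
        simp [stepS, hH0.1 _ this])) n 0 (0, -1) hn.ne'
  simp at this

theorem exists_up_step {d : ℕ} {μ : Zd d → ℝ} (hH2 : H2 d μ) :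
    ∃ w : Zd d, 1 ≤ w.2 ∧ 0 < μ w := by
  by_contra! hcon
  obtain ⟨n, hn⟩ := hH2.1 0 (0, 1)
  have := kerIter_rel (p := stepS d μ) (R := fun _ z w => w.2 ≤ z.2)
    (fun z => le_rfl) (fun _ z w w' h1 h2 => h1.trans' (by
      by_contra! hlt
      have : 1 ≤ (w' - w).2 := by simp only [Prod.snd_sub]; omega
      exact h2 (by simp [stepS, hcon _ this]))) n 0 (0, 1) hn.ne'
  simp at this

theorem exists_up_step_boundary {d : ℕ} {μ μ0 : Zd d → ℝ} (hH1 : H1 d μ μ0) :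
    ∃ w : Zd d, 1 ≤ w.2 ∧ 0 < μ0 w := by
  by_contra! hcon
  obtain ⟨n, hn⟩ := hH1 (0, 0) (0, 1)
  have := kerIter_rel (p := step d μ μ0) (R := fun _ z w => z.2 = 0 → w.2 = 0)
    (fun z => id) (fun _ z w w' h1 h2 hz => by
      by_contra hne
      have h0 := h1 hz
      have : 1 ≤ (toZ d w' - toZ d w).2 := by simp [toZ, h0]; omega
      exact h2 (by simp [step, h0, hcon _ this])) n (0, 0) (0, 1) hn.ne' rfl
  simp at this

/-! ### Geometry of the level set `φ = 1` over a fixed horizontal parameter -/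

/-- The standing hypotheses on the two jump laws that the representation uses. -/
structure Hyp (d : ℕ) (μ μ0 : Zd d → ℝ) : Prop where
  prob : IsProb d μ
  prob0 : IsProb d μ0
  skipFree : H0 d μ μ0
  irred : H1 d μ μ0
  irred_free : H2 d μ
  moments : H4 d μ μ0

theorem dotZ_vert {d : ℕ} (α : Fin (d - 1) → ℝ) (b s : ℝ) (z : Zd d) :
    dotZ d (α, s) z = dotZ d (α, b) z + (s - b) * z.2 := by
  simp only [dotZ]; ring

theorem jgf_tangent_lt {d : ℕ} {μ : Zd d → ℝ} (hμ : ∀ z, 0 ≤ μ z)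
    (h : ∀ a, Summable fun z => μ z * Real.exp (dotZ d a z)) (hw : ∃ w : Zd d, w.2 ≠ 0 ∧ 0 < μ w)
    (α : Fin (d - 1) → ℝ) {b s : ℝ} (hs : s ≠ b) :
    jgf d μ (α, b) + jgfDβ d μ (α, b) * (s - b) < jgf d μ (α, s) := by
  obtain ⟨w, hw2, hw⟩ := hw
  have h1 : HasSum (fun z => μ z * Real.exp (dotZ d (α, b) z) +
      μ z * (z.2 : ℝ) * Real.exp (dotZ d (α, b) z) * (s - b))
      (jgf d μ (α, b) + jgfDβ d μ (α, b) * (s - b)) :=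
    (h _).hasSum.add ((summable_jgfDβ hμ h _).hasSum.mul_right _)
  have e1 : ∀ z : Zd d, μ z * Real.exp (dotZ d (α, b) z) +
      μ z * (z.2 : ℝ) * Real.exp (dotZ d (α, b) z) * (s - b) =
      μ z * Real.exp (dotZ d (α, b) z) * ((s - b) * z.2 + 1) := fun z => by ring
  have e2 : ∀ z : Zd d, μ z * Real.exp (dotZ d (α, s) z) =
      μ z * Real.exp (dotZ d (α, b) z) * Real.exp ((s - b) * z.2) := fun z => by
    rw [dotZ_vert α b s, Real.exp_add]; ring
  refine hasSum_lt (i := w) (fun z => ?_) ?_ h1 (h (α, s)).hasSum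
  · simp only [e1, e2]
    exact mul_le_mul_of_nonneg_left (Real.add_one_le_exp _)
      (mul_nonneg (hμ z) (Real.exp_pos _).le)
  · simp only [e1, e2]
    refine mul_lt_mul_of_pos_left (Real.add_one_lt_exp ?_) (mul_pos hw (Real.exp_pos _))
    exact mul_ne_zero (sub_ne_zero.2 hs) (by exact_mod_cast hw2)

namespace Hyp

variable {d : ℕ} {μ μ0 : Zd d → ℝ}

theorem summable (H : Hyp d μ μ0) (a : Rd d) : Summable fun z => μ z * Real.exp (dotZ d a z) :=
  (H.moments a).1

theorem summable0 (H : Hyp d μ μ0) (a : Rd d) : Summable fun z => μ0 z * Real.exp (dotZ d a z) :=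
  (H.moments a).2

theorem tangent (H : Hyp d μ μ0) (α : Fin (d - 1) → ℝ) {b s : ℝ} (hs : s ≠ b) :
    jgf d μ (α, b) + jgfDβ d μ (α, b) * (s - b) < jgf d μ (α, s) := by
  obtain ⟨w, hw, hpos⟩ := exists_up_step H.irred_free
  exact jgf_tangent_lt H.prob.1 H.summable ⟨w, by omega, hpos⟩ α hs

theorem le_of_mem (H : Hyp d μ μ0) {α : Fin (d - 1) → ℝ} {b s : ℝ} (hb : (α, b) ∈ bdMinus d μ)
    (hs : jgf d μ (α, s) = 1) : b ≤ s := by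
  by_contra! hlt
  have h1 := H.tangent α hlt.ne
  rw [hb.1, hs] at h1
  have h2 := hb.2
  nlinarith

theorem ge_of_mem (H : Hyp d μ μ0) {α : Fin (d - 1) → ℝ} {b s : ℝ} (hs : (α, s) ∈ bdPlus d μ)
    (hb : jgf d μ (α, b) = 1) : b ≤ s := by
  by_contra! hlt
  have h1 := H.tangent α hlt.ne'
  rw [hs.1, hb] at h1
  have h2 := hs.2
  nlinarith

theorem bdMinus_unique (H : Hyp d μ μ0) {a b : Rd d} (ha : a ∈ bdMinus d μ) (hb : b ∈ bdMinus d μ)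
    (hab : a.1 = b.1) : a = b := by
  obtain ⟨α, s⟩ := a
  obtain ⟨α', t⟩ := b
  obtain rfl : α = α' := hab
  rw [(H.le_of_mem ha hb.1).antisymm (H.le_of_mem hb ha.1)]

theorem bdPlus_unique (H : Hyp d μ μ0) {a b : Rd d} (ha : a ∈ bdPlus d μ) (hb : b ∈ bdPlus d μ)
    (hab : a.1 = b.1) : a = b := by
  obtain ⟨α, s⟩ := a
  obtain ⟨α', t⟩ := b
  obtain rfl : α = α' := hab
  rw [(H.ge_of_mem hb ha.1).antisymm (H.ge_of_mem ha hb.1)]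

theorem eq_of_jgf_eq_one (H : Hyp d μ μ0) {α : Fin (d - 1) → ℝ} {b s t : ℝ}
    (hb : (α, b) ∈ bdMinus d μ) (hs : (α, s) ∈ bdPlus d μ) (ht : jgf d μ (α, t) = 1) :
    t = b ∨ t = s := by
  rcases le_total (jgfDβ d μ (α, t)) 0 with h | h
  · exact Or.inl (congrArg Prod.snd (H.bdMinus_unique (a := (α, t)) ⟨ht, h⟩ hb rfl))
  · exact Or.inr (congrArg Prod.snd (H.bdPlus_unique (a := (α, t)) ⟨ht, h⟩ hs rfl))

theorem exists_bd (H : Hyp d μ μ0) {α : Fin (d - 1) → ℝ} {β : ℝ} (hβ : jgf d μ (α, β) ≤ 1) :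
    ∃ b s, (α, b) ∈ bdMinus d μ ∧ (α, s) ∈ bdPlus d μ := by
  have hcont : Continuous fun t : ℝ => jgf d μ (α, t) :=
    (continuous_jgf H.prob.1 H.summable).comp (by fun_prop)
  have hcont' : Continuous fun t : ℝ => jgfDβ d μ (α, t) :=
    (continuous_jgfDβ H.prob.1 H.summable).comp (by fun_prop)
  by_cases hex : ∃ t, jgf d μ (α, t) < 1
  · obtain ⟨t, ht⟩ := hex
    have hterm : ∀ (w : Zd d) (B : ℝ), μ w * Real.exp (dotZ d (α, t) w + (B - t) * w.2) ≤
        jgf d μ (α, B) := fun w B => by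
      rw [← dotZ_vert]
      exact (H.summable (α, B)).le_tsum w fun z _ => mul_nonneg (H.prob.1 z) (Real.exp_pos _).le
    have hbig : ∀ w : Zd d, 0 < μ w → ∀ B, dotZ d (α, t) w + (B - t) * w.2 = (μ w)⁻¹ →
        1 < jgf d μ (α, B) := fun w hw B hB => by
      refine lt_of_lt_of_le ?_ (hterm w B)
      rw [hB]
      have := mul_lt_mul_of_pos_left (Real.add_one_lt_exp (inv_pos.2 hw).ne') hw
      rw [mul_add, mul_inv_cancel₀ hw.ne'] at this
      linarith
    have hB : ∀ w : Zd d, w.2 ≠ 0 → 0 < μ w →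
        1 < jgf d μ (α, t + ((μ w)⁻¹ - dotZ d (α, t) w) / w.2) := fun w hw2 hw => by
      refine hbig w hw _ ?_
      have : (w.2 : ℝ) ≠ 0 := by exact_mod_cast hw2
      field_simp
      ring
    have hsmall : ∀ w : Zd d, 0 < μ w → dotZ d (α, t) w < (μ w)⁻¹ := fun w hw => by
      by_contra! hcon
      have h1 := hterm w t
      rw [sub_self, zero_mul, add_zero] at h1
      have h2 := mul_le_mul_of_nonneg_left ((Real.add_one_le_exp _).trans
        (Real.exp_le_exp.2 hcon)) hw.le
      rw [mul_add, mul_inv_cancel₀ hw.ne'] at h2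
      linarith
    obtain ⟨w, hw2, hw⟩ := exists_up_step H.irred_free
    obtain ⟨w', hw2', hw'⟩ := exists_down_step H.skipFree H.irred_free
    have hup := hB w (by omega) hw
    have hdown := hB w' (by omega) hw'
    have hle : t ≤ t + ((μ w)⁻¹ - dotZ d (α, t) w) / w.2 := by
      have h1 := hsmall w hw
      have h2 : (0 : ℝ) ≤ w.2 := by exact_mod_cast (by omega : 0 ≤ w.2)
      have := div_nonneg (sub_nonneg.2 h1.le) h2
      linarith
    have hle' : t + ((μ w')⁻¹ - dotZ d (α, t) w') / w'.2 ≤ t := by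
      have h1 := hsmall w' hw'
      have h2 : (w'.2 : ℝ) ≤ 0 := by rw [hw2']; norm_num
      have := div_nonpos_of_nonneg_of_nonpos (sub_nonneg.2 h1.le) h2
      linarith
    obtain ⟨s, hs, hs1⟩ := intermediate_value_Icc hle hcont.continuousOn ⟨ht.le, hup.le⟩
    obtain ⟨b, hb, hb1⟩ := intermediate_value_Icc' hle' hcont.continuousOn ⟨ht.le, hdown.le⟩
    simp only at hs1 hb1
    refine ⟨b, s, ⟨hb1, ?_⟩, ⟨hs1, ?_⟩⟩
    · have hne : t ≠ b := by rintro rfl; linarith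
      have h1 := H.tangent α hne
      by_contra! hcon
      nlinarith [hb.2]
    · have hne : t ≠ s := by rintro rfl; linarith
      have h1 := H.tangent α hne
      by_contra! hcon
      nlinarith [hs.1]
  · push Not at hex
    have h1 : jgf d μ (α, β) = 1 := hβ.antisymm (hex β)
    have h2 : jgfDβ d μ (α, β) ≤ 0 := by
      refine le_of_tendsto (hcont'.continuousAt.tendsto.mono_left
        (nhdsWithin_le_nhds (s := Set.Iio β))) ?_
      filter_upwards [self_mem_nhdsWithin] with t ht
      have h3 := H.tangent α (b := t) (s := β) (ne_of_gt ht)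
      have h4 := hex t
      rw [h1] at h3
      by_contra! hcon
      nlinarith [mul_pos hcon (sub_pos.2 ht)]
    have h3 : 0 ≤ jgfDβ d μ (α, β) := by
      refine ge_of_tendsto (hcont'.continuousAt.tendsto.mono_left
        (nhdsWithin_le_nhds (s := Set.Ioi β))) ?_
      filter_upwards [self_mem_nhdsWithin] with t ht
      have h3 := H.tangent α (b := t) (s := β) (ne_of_lt ht)
      have h4 := hex t
      rw [h1] at h3
      by_contra! hcon
      nlinarith [mul_pos_of_neg_of_neg hcon (sub_neg.2 ht)]
    exact ⟨β, β, ⟨h1, h2⟩, ⟨h1, h3⟩⟩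

theorem jgf_boundary_strictMono (H : Hyp d μ μ0) (α : Fin (d - 1) → ℝ) :
    StrictMono fun t : ℝ => jgf d μ0 (α, t) := by
  intro b s hbs
  obtain ⟨w, hw2, hw⟩ := exists_up_step_boundary H.irred
  refine hasSum_lt (i := w) (fun z => ?_) ?_ (H.summable0 (α, b)).hasSum (H.summable0 (α, s)).hasSum
  · by_cases hz : z.2 < 0
    · simp [H.skipFree.2 z hz]
    · refine mul_le_mul_of_nonneg_left (Real.exp_le_exp.2 ?_) (H.prob0.1 z)
      rw [dotZ_vert α b s]
      have : (0 : ℝ) ≤ z.2 := by exact_mod_cast not_lt.1 hz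
      nlinarith
  · refine mul_lt_mul_of_pos_left (Real.exp_lt_exp.2 ?_) hw
    rw [dotZ_vert α b s]
    have : (1 : ℝ) ≤ w.2 := by exact_mod_cast hw2
    nlinarith

theorem jgfDβ_boundary_pos (H : Hyp d μ μ0) (a : Rd d) : 0 < jgfDβ d μ0 a := by
  obtain ⟨w, hw2, hw⟩ := exists_up_step_boundary H.irred
  refine (summable_jgfDβ H.prob0.1 H.summable0 a).tsum_pos (fun z => ?_) w ?_
  · by_cases hz : z.2 < 0
    · simp [H.skipFree.2 z hz]
    · have : (0 : ℝ) ≤ z.2 := by exact_mod_cast not_lt.1 hz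
      have := H.prob0.1 z
      positivity
  · have : (0 : ℝ) < w.2 := by exact_mod_cast (by omega : 0 < w.2)
    positivity

theorem abarF_spec (H : Hyp d μ μ0) {a : Rd d} (ha : jgf d μ a ≤ 1) :
    abarF d μ a ∈ bdMinus d μ ∧ (abarF d μ a).1 = a.1 := by
  obtain ⟨b, -, hb, -⟩ := H.exists_bd (α := a.1) (β := a.2) ha
  have hex : ∃ b : Rd d, b ∈ bdMinus d μ ∧ b.1 = a.1 := ⟨_, hb, rfl⟩
  rw [abarF, dif_pos hex]
  exact hex.choose_spec

theorem abarF_eq (H : Hyp d μ μ0) {a b : Rd d} (hb : b ∈ bdMinus d μ) (hab : b.1 = a.1) :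
    abarF d μ a = b := by
  have hex : ∃ b : Rd d, b ∈ bdMinus d μ ∧ b.1 = a.1 := ⟨_, hb, hab⟩
  rw [abarF, dif_pos hex]
  exact H.bdMinus_unique hex.choose_spec.1 hb (hex.choose_spec.2.trans hab.symm)

theorem mem_Theta_iff (H : Hyp d μ μ0) {α : Fin (d - 1) → ℝ} {b : ℝ} (hb : (α, b) ∈ bdMinus d μ) :
    α ∈ Theta d μ μ0 ↔ jgf d μ0 (α, b) ≤ 1 := by
  have hnn : ∀ t, 0 ≤ jgf d μ (α, t) := fun t =>
    tsum_nonneg fun z => mul_nonneg (H.prob.1 z) (Real.exp_pos _).le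
  constructor
  · intro hα
    by_contra! hcon
    have hcont : ContinuousAt (fun t : ℝ => jgf d μ0 (α, t)) b :=
      ((continuous_jgf H.prob0.1 H.summable0).comp (by fun_prop)).continuousAt
    obtain ⟨t, ht, htb⟩ : ∃ t, 1 < jgf d μ0 (α, t) ∧ t < b := by
      have h1 := (hcont.eventually (lt_mem_nhds hcon)).filter_mono
        (nhdsWithin_le_nhds (s := Set.Iio b))
      exact (h1.and self_mem_nhdsWithin).exists
    have htan : 1 < jgf d μ (α, t) := by
      have h1 := H.tangent α htb.ne
      rw [hb.1] at h1
      nlinarith [hb.2]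
    have hmin : min (jgf d μ (α, t)) (jgf d μ0 (α, t)) ≤
        ⨅ β : ℝ, max (jgf d μ (α, β)) (jgf d μ0 (α, β)) := by
      refine le_ciInf fun β => ?_
      rcases le_total t β with h | h
      · exact (min_le_right _ _).trans (((H.jgf_boundary_strictMono α).monotone h).trans
          (le_max_right _ _))
      · refine (min_le_left _ _).trans (le_trans ?_ (le_max_left _ _))
        rcases h.eq_or_lt with rfl | h
        · exact le_rfl
        have h1 := H.tangent α (b := t) h.ne
        have h2 := H.tangent α (b := t) htb.ne'
        rw [hb.1] at h2
        have h3 : jgfDβ d μ (α, t) < 0 := by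
          by_contra! hc
          nlinarith
        nlinarith
    exact absurd (hmin.trans hα) (not_le.2 (lt_min htan ht))
  · intro hle
    refine (ciInf_le (f := fun β : ℝ => max (jgf d μ (α, β)) (jgf d μ0 (α, β))) ⟨0, ?_⟩ b).trans
      (max_le hb.1.le hle)
    rintro _ ⟨t, rfl⟩
    exact (hnn t).trans (le_max_left _ _)

/-! ### The harmonic functions `h_a` -/

theorem summable_jump (H : Hyp d μ μ0) (z : St d) (a : Rd d) :
    Summable fun w => jump μ μ0 z w * Real.exp (dotZ d a w) := by
  unfold jump; split_ifs
  · exact H.summable0 a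
  · exact H.summable a

theorem hasSum_stepR_exp (H : Hyp d μ μ0) (z : St d) (a : Rd d) :
    HasSum (fun z' => stepR d μ μ0 z z' * Real.exp (dotZ d a (toZ d z')))
      (Real.exp (dotZ d a (toZ d z)) * jgf d (jump μ μ0 z) a) := by
  rw [hasSum_stepR H.skipFree z fun v => Real.exp (dotZ d a v)]
  refine ((H.summable_jump z a).hasSum.mul_left _).of_eq (fun w => ?_) rfl
  rw [dotZ_add_right, Real.exp_add]; ring

theorem hasSum_stepR_mul_exp (H : Hyp d μ μ0) (z : St d) (a : Rd d) :
    HasSum (fun z' => stepR d μ μ0 z z' * ((z'.2 : ℝ) * Real.exp (dotZ d a (toZ d z'))))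
      (Real.exp (dotZ d a (toZ d z)) * (z.2 * jgf d (jump μ μ0 z) a + jgfDβ d (jump μ μ0 z) a)) := by
  have h1 := (hasSum_stepR H.skipFree z (fun v => (v.2 : ℝ) * Real.exp (dotZ d a v))
    (Real.exp (dotZ d a (toZ d z)) *
      (z.2 * jgf d (jump μ μ0 z) a + jgfDβ d (jump μ μ0 z) a))).2 ?_
  · refine h1.of_eq (fun z' => ?_) rfl
    simp [toZ]
  · refine ((((H.summable_jump z a).hasSum.mul_left (z.2 : ℝ)).add
      (summable_jgfDβ (jump_nonneg H.prob H.prob0 z) (H.summable_jump z) a).hasSum).mul_left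
        (Real.exp (dotZ d a (toZ d z)))).of_eq (fun w => ?_) rfl
    rw [dotZ_add_right, Real.exp_add]
    simp only [toZ, Prod.snd_add, Int.cast_add, Int.cast_natCast]
    ring

theorem hfun_isHarmonic (H : Hyp d μ μ0) {α : Fin (d - 1) → ℝ} {b s : ℝ}
    (hb : (α, b) ∈ bdMinus d μ) (hs : (α, s) ∈ bdPlus d μ) :
    IsHarmonic d μ μ0 (hfun d μ μ0 (α, s) (α, b)) := by
  intro z
  have hexp : z.2 = 0 → ∀ t, dotZ d (α, t) (toZ d z) = dotZ d (α, b) (toZ d z) := fun h0 t => by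
    rw [dotZ_vert α b t]; simp [toZ, h0]
  unfold hfun
  split_ifs with h1 h2
  · refine (H.hasSum_stepR_exp z (α, b)).of_eq (fun _ => rfl) ?_
    unfold jump; split_ifs
    · rw [h1, mul_one]
    · rw [hb.1, mul_one]
  · obtain rfl : s = b := congrArg Prod.snd h2
    have hD : jgfDβ d μ (α, s) = 0 := hb.2.antisymm hs.2
    refine ((H.hasSum_stepR_mul_exp z (α, s)).add ((H.hasSum_stepR_exp z (α, s)).mul_left
      (jgfDβ d μ0 (α, s) / (1 - jgf d μ0 (α, s))))).of_eq (fun _ => by ring) ?_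
    unfold jump; split_ifs with h0
    · have : 1 - jgf d μ0 (α, s) ≠ 0 := sub_ne_zero.2 (Ne.symm h1)
      simp only [h0, Nat.cast_zero]
      field_simp
      ring
    · rw [hD, hb.1]; ring
  · refine ((H.hasSum_stepR_exp z (α, s)).sub ((H.hasSum_stepR_exp z (α, b)).mul_left
      ((1 - jgf d μ0 (α, s)) / (1 - jgf d μ0 (α, b))))).of_eq (fun _ => by ring) ?_
    unfold jump; split_ifs with h0
    · have : 1 - jgf d μ0 (α, b) ≠ 0 := sub_ne_zero.2 (Ne.symm h1)
      rw [hexp h0 s]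
      field_simp
      ring
    · rw [hb.1, hs.1]; ring

theorem hfun_pos (H : Hyp d μ μ0) {α : Fin (d - 1) → ℝ} {b s : ℝ}
    (hb : (α, b) ∈ bdMinus d μ) (hs : (α, s) ∈ bdPlus d μ) (h0 : jgf d μ0 (α, b) ≤ 1) (z : St d) :
    0 < hfun d μ μ0 (α, s) (α, b) z := by
  have hbs : b ≤ s := H.le_of_mem hb hs.1
  unfold hfun
  split_ifs with h1 h2
  · exact Real.exp_pos _
  · obtain rfl : s = b := congrArg Prod.snd h2
    have h3 : 0 < 1 - jgf d μ0 (α, s) := sub_pos.2 (lt_of_le_of_ne h0 h1)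
    have h4 := H.jgfDβ_boundary_pos (α, s)
    positivity
  · have h3 : 0 < 1 - jgf d μ0 (α, b) := sub_pos.2 (lt_of_le_of_ne h0 h1)
    have hlt : b < s := lt_of_le_of_ne hbs fun h => h2 (by rw [h])
    have h4 : (1 - jgf d μ0 (α, s)) / (1 - jgf d μ0 (α, b)) < 1 := by
      rw [div_lt_one h3]
      have := H.jgf_boundary_strictMono α hlt
      simp only at this
      linarith
    have h5 : Real.exp (dotZ d (α, b) (toZ d z)) ≤ Real.exp (dotZ d (α, s) (toZ d z)) := by
      rw [Real.exp_le_exp, dotZ_vert α b s]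
      have : (0 : ℝ) ≤ (toZ d z).2 := by simp [toZ]
      nlinarith
    have := mul_lt_mul_of_pos_right h4 (Real.exp_pos (dotZ d (α, b) (toZ d z)))
    linarith

end Hyp

/-! ### Measurability -/

open Classical in
/-- A point of `M` above `α`, or `0` if there is none. -/
noncomputable def section1 {d : ℕ} (M : Set (Rd d)) (α : Fin (d - 1) → ℝ) : Rd d :=
  if h : ∃ b : Rd d, b ∈ M ∧ b.1 = α then h.choose else 0

theorem section1_eq {d : ℕ} {M : Set (Rd d)} (hinj : Set.InjOn Prod.fst M) {b : Rd d}
    (hb : b ∈ M) : section1 M b.1 = b := by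
  have hex : ∃ c : Rd d, c ∈ M ∧ c.1 = b.1 := ⟨b, hb, rfl⟩
  rw [section1, dif_pos hex]
  exact hinj hex.choose_spec.1 hb hex.choose_spec.2

theorem measurable_section1 {d : ℕ} {M : Set (Rd d)} (hM : MeasurableSet M)
    (hinj : Set.InjOn Prod.fst M) : Measurable (section1 M) := by
  have hemb := continuous_fst.continuousOn.measurableEmbedding hM hinj
  have : section1 M = Function.extend (M.domRestrict Prod.fst) Subtype.val 0 := by
    funext α
    by_cases hex : ∃ b : Rd d, b ∈ M ∧ b.1 = α
    · obtain ⟨b, hb, rfl⟩ := hex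
      exact (section1_eq hinj hb).trans (hemb.injective.extend_apply Subtype.val 0 ⟨b, hb⟩).symm
    · have hex' : ¬ ∃ b, M.domRestrict Prod.fst b = α := fun ⟨b, hb⟩ => hex ⟨b.1, b.2, hb⟩
      rw [Function.extend_apply' _ _ _ hex', section1, dif_neg hex]
      rfl
  rw [this]
  exact hemb.measurable_extend measurable_subtype_coe measurable_zero

/-- The parameter set `(Θ × ℝ) ∩ ∂₊D`. -/
def paramSet (d : ℕ) (μ μ0 : Zd d → ℝ) : Set (Rd d) :=
  {a | a.1 ∈ Theta d μ μ0 ∧ a ∈ bdPlus d μ}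

namespace Hyp

variable {d : ℕ} {μ μ0 : Zd d → ℝ}

theorem injOn_bdMinus (H : Hyp d μ μ0) : Set.InjOn Prod.fst (bdMinus d μ) :=
  fun _ ha _ hb hab => H.bdMinus_unique ha hb hab

theorem injOn_bdPlus (H : Hyp d μ μ0) : Set.InjOn Prod.fst (bdPlus d μ) :=
  fun _ ha _ hb hab => H.bdPlus_unique ha hb hab

theorem measurableSet_bdMinus (H : Hyp d μ μ0) : MeasurableSet (bdMinus d μ) :=
  (isClosed_eq (continuous_jgf H.prob.1 H.summable) continuous_const).measurableSet.inter
    (isClosed_le (continuous_jgfDβ H.prob.1 H.summable) continuous_const).measurableSet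

theorem measurableSet_bdPlus (H : Hyp d μ μ0) : MeasurableSet (bdPlus d μ) :=
  (isClosed_eq (continuous_jgf H.prob.1 H.summable) continuous_const).measurableSet.inter
    (isClosed_le continuous_const (continuous_jgfDβ H.prob.1 H.summable)).measurableSet

theorem measurable_abarF (H : Hyp d μ μ0) : Measurable (abarF d μ) :=
  (measurable_section1 H.measurableSet_bdMinus H.injOn_bdMinus).comp measurable_fst

theorem mem_paramSet_iff (H : Hyp d μ μ0) {a : Rd d} :
    a ∈ paramSet d μ μ0 ↔ a ∈ bdPlus d μ ∧ jgf d μ0 (abarF d μ a) ≤ 1 := by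
  rw [paramSet, Set.mem_ofPred_eq, and_comm]
  refine and_congr_right fun ha => ?_
  obtain ⟨h1, h2⟩ := H.abarF_spec ha.1.le
  rw [← h2]
  exact H.mem_Theta_iff h1

theorem measurableSet_paramSet (H : Hyp d μ μ0) : MeasurableSet (paramSet d μ μ0) := by
  have : paramSet d μ μ0 = bdPlus d μ ∩ {a | jgf d μ0 (abarF d μ a) ≤ 1} :=
    Set.ext fun a => H.mem_paramSet_iff
  rw [this]
  exact H.measurableSet_bdPlus.inter (measurableSet_le
    ((continuous_jgf H.prob0.1 H.summable0).measurable.comp H.measurable_abarF) measurable_const)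

theorem measurable_hfun (H : Hyp d μ μ0) (z : St d) :
    Measurable fun a => hfun d μ μ0 a (abarF d μ a) z := by
  have hb := H.measurable_abarF
  have hφ := (continuous_jgf H.prob0.1 H.summable0).measurable
  have hD := (continuous_jgfDβ H.prob0.1 H.summable0).measurable
  have hdot : Measurable fun a => Real.exp (dotZ d a (toZ d z)) := by
    refine Continuous.measurable ?_
    unfold dotZ; fun_prop
  unfold hfun
  refine Measurable.ite (measurableSet_eq_fun (hφ.comp hb) measurable_const) (hdot.comp hb)
    (Measurable.ite (measurableSet_eq_fun measurable_id hb) ?_ ?_)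
  · exact (measurable_const.mul hdot).add ((hD.div (measurable_const.sub hφ)).mul hdot)
  · exact hdot.sub (((measurable_const.sub hφ).div (measurable_const.sub (hφ.comp hb))).mul
      (hdot.comp hb))

theorem hfun_isHarmonic_of_mem (H : Hyp d μ μ0) {a : Rd d} (ha : a ∈ paramSet d μ μ0) :
    IsHarmonic d μ μ0 (hfun d μ μ0 a (abarF d μ a)) := by
  obtain ⟨h1, h2⟩ := H.abarF_spec ha.2.1.le
  have := H.hfun_isHarmonic (α := a.1) (b := (abarF d μ a).2) (s := a.2) (h2 ▸ h1) ha.2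
  rwa [← h2, Prod.mk.eta, h2] at this

theorem hfun_pos_of_mem (H : Hyp d μ μ0) {a : Rd d} (ha : a ∈ paramSet d μ μ0) (z : St d) :
    0 < hfun d μ μ0 a (abarF d μ a) z := by
  obtain ⟨h1, h2⟩ := H.abarF_spec ha.2.1.le
  have h3 := (H.mem_paramSet_iff.1 ha).2
  have := H.hfun_pos (α := a.1) (b := (abarF d μ a).2) (s := a.2) (h2 ▸ h1) ha.2 (h2 ▸ h3) z
  rwa [← h2, Prod.mk.eta, h2] at this

/-! ### Integrals of the functions `h_a` are harmonic -/

theorem integral_hfun (H : Hyp d μ μ0) (ν : Measure (Rd d)) (z : St d) :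
    ∫ a in paramSet d μ μ0, hfun d μ μ0 a (abarF d μ a) z ∂ν =
      (∫⁻ a in paramSet d μ μ0, ENNReal.ofReal (hfun d μ μ0 a (abarF d μ a) z) ∂ν).toReal := by
  refine integral_eq_lintegral_of_nonneg_ae ?_ (H.measurable_hfun z).aestronglyMeasurable
  filter_upwards [ae_restrict_mem H.measurableSet_paramSet] with a ha
  exact (H.hfun_pos_of_mem ha z).le

theorem isHarmonic_integral (H : Hyp d μ μ0) (ν : Measure (Rd d)) :
    IsHarmonic d μ μ0 fun z =>
      ∫ a in paramSet d μ μ0, hfun d μ μ0 a (abarF d μ a) z ∂ν := by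
  simp only [H.integral_hfun ν]
  set I : St d → ℝ≥0∞ := fun z =>
    ∫⁻ a in paramSet d μ μ0, ENNReal.ofReal (hfun d μ μ0 a (abarF d μ a) z) ∂ν with hI
  have hharm : ∀ z, ∑' z', step d μ μ0 z z' * I z' = I z := fun z => by
    have hm : ∀ z', Measurable fun a => ENNReal.ofReal (hfun d μ μ0 a (abarF d μ a) z') :=
      fun z' => (H.measurable_hfun z').ennreal_ofReal
    calc ∑' z', step d μ μ0 z z' * I z'
        = ∫⁻ a in paramSet d μ μ0,
            ∑' z', step d μ μ0 z z' * ENNReal.ofReal (hfun d μ μ0 a (abarF d μ a) z') ∂ν := by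
          rw [lintegral_tsum fun z' => ((hm z').const_mul _).aemeasurable]
          exact tsum_congr fun z' => (lintegral_const_mul _ (hm z')).symm
      _ = I z := setLIntegral_congr_fun H.measurableSet_paramSet fun a ha =>
          tsum_step_ofReal H.prob H.prob0 (fun z' => (H.hfun_pos_of_mem ha z').le)
            (H.hfun_isHarmonic_of_mem ha) z
  by_cases hfin : ∀ z, I z ≠ ⊤
  · exact isHarmonic_toReal H.prob H.prob0 hfin hharm
  · push Not at hfin
    obtain ⟨w, hw⟩ := hfin
    have htop : ∀ z, I z = ⊤ := fun z => by
      obtain ⟨k, hk⟩ := H.irred z w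
      have := kerIter_mul_le (H := I) (fun z => (hharm z).le) k z w
      exact top_le_iff.1 ((ENNReal.mul_top hk.ne').symm.le.trans (hw ▸ this))
    intro z
    refine hasSum_zero.of_eq (fun z' => ?_) ?_
    · change _ * (I z').toReal = 0
      rw [htop, ENNReal.toReal_top, mul_zero]
    · change (I z).toReal = 0
      rw [htop, ENNReal.toReal_top]

end Hyp

/-! ### Harmonic functions that are exponential in the horizontal direction -/

/-- The horizontal exponent of a function that is multiplicative along horizontal shifts. -/
noncomputable def slope {d : ℕ} (f : St d → ℝ) : Fin (d - 1) → ℝ :=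
  fun i => Real.log (f (Pi.single i 1, 0))

theorem eq_exp_slope_mul {d : ℕ} {f : St d → ℝ} (hpos : ∀ z, 0 < f z)
    (hmul : ∀ x z, f (z + (x, 0)) = f (x, 0) * f z) (z : St d) :
    f z = Real.exp (dotZ d (slope f, 0) (toZ d z)) * f (0, z.2) := by
  set G : (Fin (d - 1) → ℤ) →+ ℝ := AddMonoidHom.mk' (fun x => Real.log (f (x, 0))) fun x y => by
    have := hmul y (x, 0)
    rw [Prod.mk_add_mk, add_zero] at this
    rw [this, mul_comm, Real.log_mul (hpos _).ne' (hpos _).ne'] with hG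
  have hGx : ∀ x, G x = ∑ i, slope f i * (x i : ℝ) := fun x => by
    conv_lhs => rw [← Finset.univ_sum_single x]
    rw [map_sum]
    refine Finset.sum_congr rfl fun i _ => ?_
    have : (Pi.single i (x i) : Fin (d - 1) → ℤ) = x i • Pi.single i 1 := by
      ext j; simp [Pi.single_apply]
    rw [this, map_zsmul, zsmul_eq_mul, mul_comm]
    rfl
  have h1 : f z = f (z.1, 0) * f (0, z.2) := by
    rw [← hmul z.1 (0, z.2)]; simp
  have h2 : Real.exp (G z.1) = f (z.1, 0) := Real.exp_log (hpos _)
  rw [h1, ← h2, hGx]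
  simp [dotZ, toZ]

theorem hasSum_marginal {d : ℕ} {V : Zd d → ℝ} (hV : ∀ w, w.2 < -1 → V w = 0) {G : ℕ → ℝ} {b : ℝ}
    (h : HasSum (fun w => V w * G (w.2 + 1).toNat) b) :
    HasSum (fun j : ℕ => (∑' x, V (x, (j : ℤ) - 1)) * G j) b := by
  have h1 := (Equiv.prodComm ℤ (Fin (d - 1) → ℤ)).hasSum_iff.2 h
  have h2 := h1.prod_fiberwise fun y => (h1.summable.prod_factor y).hasSum
  have hinj : Function.Injective fun j : ℕ => (j : ℤ) - 1 := fun a b hab => by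
    simpa using hab
  rw [← hinj.hasSum_iff] at h2
  · refine h2.of_eq (fun j => ?_) rfl
    simp [tsum_mul_right]
  · intro y hy
    have hy' : y < -1 := by
      by_contra! hc
      exact hy ⟨(y + 1).toNat, by simp only; omega⟩
    simp [hV (_, y) hy']

namespace Hyp

variable {d : ℕ} {μ μ0 : Zd d → ℝ}

/-- Exponentially tilted law of the vertical jump, shifted by one. -/
noncomputable def vert (μ : Zd d → ℝ) (α : Fin (d - 1) → ℝ) (j : ℕ) : ℝ :=
  ∑' x, μ (x, (j : ℤ) - 1) * Real.exp (dotZ d (α, 0) (x, (j : ℤ) - 1))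

theorem vert_nonneg (H : Hyp d μ μ0) (α : Fin (d - 1) → ℝ) (j : ℕ) : 0 ≤ vert μ α j :=
  tsum_nonneg fun _ => mul_nonneg (H.prob.1 _) (Real.exp_pos _).le

theorem vert_pos (H : Hyp d μ μ0) (α : Fin (d - 1) → ℝ) {w : Zd d} (hw : 0 < μ w) {j : ℕ}
    (hj : w.2 = (j : ℤ) - 1) : 0 < vert μ α j := by
  have h1 := ((Equiv.prodComm ℤ (Fin (d - 1) → ℤ)).summable_iff.2 (H.summable (α, 0))).prod_factor
    ((j : ℤ) - 1)
  refine Summable.tsum_pos h1 (fun x => mul_nonneg (H.prob.1 _) (Real.exp_pos _).le) w.1 ?_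
  have : (w.1, (j : ℤ) - 1) = w := by rw [← hj]
  change 0 < μ (w.1, (j : ℤ) - 1) * Real.exp (dotZ d (α, 0) (w.1, (j : ℤ) - 1))
  rw [this]
  positivity

theorem hasSum_vert (H : Hyp d μ μ0) (α : Fin (d - 1) → ℝ) {G : ℕ → ℝ} {b : ℝ}
    (h : HasSum (fun w => μ w * Real.exp (dotZ d (α, 0) w) * G (w.2 + 1).toNat) b) :
    HasSum (fun j => vert μ α j * G j) b :=
  hasSum_marginal (V := fun w => μ w * Real.exp (dotZ d (α, 0) w))
    (fun w hw => by simp [H.skipFree.1 w hw]) h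

theorem hasSum_vert_exp (H : Hyp d μ μ0) (α : Fin (d - 1) → ℝ) (β : ℝ) :
    HasSum (fun j : ℕ => vert μ α j * Real.exp (β * j)) (Real.exp β * jgf d μ (α, β)) := by
  refine H.hasSum_vert α (G := fun j => Real.exp (β * j)) (((H.summable (α, β)).hasSum.mul_left
    (Real.exp β)).of_eq (fun w => ?_) rfl)
  by_cases hw : w.2 < -1
  · simp [H.skipFree.1 w hw]
  · have : (((w.2 + 1).toNat : ℕ) : ℝ) = (w.2 : ℝ) + 1 := by
      exact_mod_cast Int.toNat_of_nonneg (by omega : 0 ≤ w.2 + 1)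
    rw [this, dotZ_vert α 0 β, sub_zero, Real.exp_add, mul_add, Real.exp_add, mul_one]
    ring

theorem hasSum_vert_mul_exp (H : Hyp d μ μ0) (α : Fin (d - 1) → ℝ) (β : ℝ) :
    HasSum (fun j : ℕ => vert μ α j * (j * Real.exp (β * j)))
      (Real.exp β * (jgfDβ d μ (α, β) + jgf d μ (α, β))) := by
  refine H.hasSum_vert α (G := fun j => j * Real.exp (β * j))
    ((((summable_jgfDβ H.prob.1 H.summable (α, β)).hasSum.add (H.summable (α, β)).hasSum).mul_left
    (Real.exp β)).of_eq (fun w => ?_) rfl)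
  by_cases hw : w.2 < -1
  · simp [H.skipFree.1 w hw]
  · have : (((w.2 + 1).toNat : ℕ) : ℝ) = (w.2 : ℝ) + 1 := by
      exact_mod_cast Int.toNat_of_nonneg (by omega : 0 ≤ w.2 + 1)
    simp only [this]
    rw [dotZ_vert α 0 β, sub_zero, Real.exp_add, mul_add, Real.exp_add, mul_one]
    ring

theorem hasSum_vert_harmonic (H : Hyp d μ μ0) {f : St d → ℝ} (hharm : IsHarmonic d μ μ0 f)
    (hpos : ∀ z, 0 < f z) (hmul : ∀ x z, f (z + (x, 0)) = f (x, 0) * f z) (y : ℕ) :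
    HasSum (fun j => vert μ (slope f) j * f (0, y + j)) (f (0, y + 1)) := by
  refine H.hasSum_vert (slope f) (G := fun j => f (0, y + j)) ?_
  refine ((isHarmonic_iff_jump H.skipFree).1 hharm (0, y + 1)).of_eq (fun w => ?_) rfl
  simp only [jump, Nat.succ_ne_zero, if_false]
  by_cases hw : w.2 < -1
  · simp [H.skipFree.1 w hw]
  · have : toZ d (0, y + 1) + w = toZ d (w.1, y + (w.2 + 1).toNat) := by
      refine Prod.ext (by simp [toZ]) ?_
      simp only [toZ, Prod.snd_add]
      omega
    rw [this, extZ_toZ, eq_exp_slope_mul hpos hmul (w.1, _), mul_assoc]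
    simp [dotZ, toZ]

theorem exists_vertical_form (H : Hyp d μ μ0) {f : St d → ℝ} (hharm : IsHarmonic d μ μ0 f)
    (hpos : ∀ z, 0 < f z) (hmul : ∀ x z, f (z + (x, 0)) = f (x, 0) * f z) :
    ∃ b s, (slope f, b) ∈ bdMinus d μ ∧ (slope f, s) ∈ bdPlus d μ ∧ ∃ c, 0 < c ∧ ∃ B, 0 ≤ B ∧
      (∀ y, f (0, y) = Real.exp (b * y) * (f 0 + B * ∑ i ∈ Finset.range y, c ^ i)) ∧
      (B = 0 ∨ (c = 1 ∧ s = b) ∨ (s ≠ b ∧ c = Real.exp (s - b))) := by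
  set α := slope f with hα
  have hp := H.vert_nonneg α
  obtain ⟨w, hw2, hw⟩ := exists_up_step H.irred_free
  obtain ⟨w', hw2', hw'⟩ := exists_down_step H.skipFree H.irred_free
  have hp0 : 0 < vert μ α 0 := H.vert_pos α hw' (by simpa using hw2')
  have hp2 : ∃ j, 2 ≤ j ∧ 0 < vert μ α j :=
    ⟨(w.2 + 1).toNat, by omega, H.vert_pos α hw (by omega)⟩
  have hF := H.hasSum_vert_harmonic hharm hpos hmul
  obtain ⟨c₀, hc₀, hsub⟩ := exists_subcritical_of_harmonic hp hp0 hp2 (fun y => hpos (0, y)) hF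
  have hβ : jgf d μ (α, Real.log c₀) ≤ 1 := by
    have h1 := (H.hasSum_vert_exp α (Real.log c₀)).tsum_eq
    simp only [mul_comm (Real.log c₀), Real.exp_nat_mul, Real.exp_log hc₀] at h1
    rw [h1] at hsub
    exact (mul_le_iff_le_one_right hc₀).1 hsub
  obtain ⟨b, s, hb, hs⟩ := H.exists_bd hβ
  refine ⟨b, s, hb, hs, ?_⟩
  have hexp : ∀ j : ℕ, Real.exp (b * (j : ℝ)) ≠ 0 := fun j => (Real.exp_pos _).ne'
  have hone : HasSum (fun j : ℕ => Real.exp (-b) * (vert μ α j * Real.exp (b * j))) 1 := by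
    refine ((H.hasSum_vert_exp α b).mul_left (Real.exp (-b))).of_eq (fun _ => rfl) ?_
    rw [hb.1, mul_one, ← Real.exp_add, neg_add_cancel, Real.exp_zero]
  have hmean : ∑' j : ℕ, Real.exp (-b) * (vert μ α j * Real.exp (b * j)) * j =
      jgfDβ d μ (α, b) + 1 := by
    refine HasSum.tsum_eq (((H.hasSum_vert_mul_exp α b).mul_left (Real.exp (-b))).of_eq
      (fun j => by ring) ?_)
    rw [hb.1, ← mul_assoc, ← Real.exp_add, neg_add_cancel, Real.exp_zero, one_mul]
  obtain ⟨c, hc, B, hB, hform, hcase⟩ := skipFree_harmonic_form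
    (p := fun j => Real.exp (-b) * (vert μ α j * Real.exp (b * j)))
    (F := fun y => Real.exp (-(b * y)) * f (0, y))
    (fun j => by have := hp j; positivity) (by positivity) hone
    (by rw [hmean]; linarith [hb.2])
    (fun R => by
      refine Summable.of_norm_bounded (((H.hasSum_vert_exp α
        (b + Real.log (|R| + 1))).summable).mul_left (Real.exp (-b))) fun j => ?_
      have h1 : 0 < |R| + 1 := by positivity
      have h2 : Real.exp (Real.log (|R| + 1) * j) = (|R| + 1) ^ j := by
        rw [mul_comm, Real.exp_nat_mul, Real.exp_log h1]
      rw [norm_mul, norm_pow, Real.norm_eq_abs, Real.norm_eq_abs,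
        abs_of_nonneg (by have := hp j; positivity), add_mul, Real.exp_add, h2, mul_assoc,
        mul_assoc]
      have := hp j
      gcongr
      linarith)
    (by obtain ⟨j, hj, hpj⟩ := hp2; exact ⟨j, hj, by positivity⟩)
    (fun y => by have := hpos (0, y); positivity)
    (fun y => by
      refine ((hF y).mul_left (Real.exp (-(b * (y + 1 : ℕ))))).of_eq (fun j => ?_) rfl
      have : Real.exp (-b) * Real.exp (b * j) * Real.exp (-(b * (y + j : ℕ))) =
          Real.exp (-(b * (y + 1 : ℕ))) := by
        rw [← Real.exp_add, ← Real.exp_add]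
        congr 1
        push_cast
        ring
      rw [← this]
      ring)
  have hzero : Real.exp (-(b * (0 : ℕ))) * f (0, 0) = f 0 := by
    simp only [Nat.cast_zero, mul_zero, neg_zero, Real.exp_zero, one_mul]
    rfl
  refine ⟨c, hc, B, hB, fun y => ?_, ?_⟩
  · have h1 := hform y
    rw [hzero] at h1
    rw [← h1, ← mul_assoc, ← Real.exp_add, add_neg_cancel, Real.exp_zero, one_mul]
  · rcases hcase with h | ⟨h, hm⟩ | ⟨hc1, h⟩
    · exact Or.inl h
    · refine Or.inr (Or.inl ⟨h, ?_⟩)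
      rw [hmean] at hm
      have hbp : (α, b) ∈ bdPlus d μ := ⟨hb.1, by linarith⟩
      exact congrArg Prod.snd (H.bdPlus_unique hs hbp rfl)
    · refine Or.inr (Or.inr ?_)
      have h1 := ((H.hasSum_vert_exp α (b + Real.log c)).mul_left (Real.exp (-b))).unique
        (h.of_eq (fun j => by
          rw [add_mul, Real.exp_add, mul_comm (Real.log c), Real.exp_nat_mul, Real.exp_log hc]
          ring) rfl)
      rw [← mul_assoc, ← Real.exp_add, neg_add_cancel_left, Real.exp_log hc] at h1
      have h2 : jgf d μ (α, b + Real.log c) = 1 := mul_left_cancel₀ hc.ne' (h1.trans (mul_one c).symm)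
      have hlog : Real.log c ≠ 0 := Real.log_ne_zero_of_pos_of_ne_one hc hc1
      rcases H.eq_of_jgf_eq_one hb hs h2 with h3 | h3
      · exact absurd (by linarith) hlog
      · refine ⟨fun h4 => hlog (by linarith), ?_⟩
        rw [← h3, add_sub_cancel_left, Real.exp_log hc]

theorem exists_param (H : Hyp d μ μ0) {f : St d → ℝ} (hharm : IsHarmonic d μ μ0 f)
    (hpos : ∀ z, 0 < f z) (hone : f 0 = 1) (hmul : ∀ x z, f (z + (x, 0)) = f (x, 0) * f z) :
    ∃ b s, (slope f, b) ∈ bdMinus d μ ∧ (slope f, s) ∈ bdPlus d μ ∧ jgf d μ0 (slope f, b) ≤ 1 ∧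
      ∀ z, hfun d μ μ0 (slope f, s) (slope f, b) z =
        f z * hfun d μ μ0 (slope f, s) (slope f, b) 0 := by
  obtain ⟨b, s, hb, hs, c, hc, B, hB, hF, hcase⟩ := H.exists_vertical_form hharm hpos hmul
  refine ⟨b, s, hb, hs, ?_⟩
  set α := slope f with hα
  have hf : ∀ z, f z = Real.exp (dotZ d (α, b) (toZ d z)) *
      (1 + B * ∑ i ∈ Finset.range z.2, c ^ i) := fun z => by
    rw [eq_exp_slope_mul hpos hmul z, hF, hone, dotZ_vert (slope f) 0 b, Real.exp_add]
    simp only [toZ, Int.cast_natCast, sub_zero]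
    ring
  have hexp0 : ∀ a, Real.exp (dotZ d a (toZ d 0)) = 1 := fun a => by simp [dotZ, toZ]
  have hjump : jump μ μ0 (0 : St d) = μ0 := if_pos rfl
  have hS := fun a => H.hasSum_stepR_exp 0 a
  simp only [hexp0, hjump, one_mul] at hS
  have h0 := hharm 0
  rw [hone] at h0
  rcases hB.eq_or_lt with rfl | hBpos
  · have h1 : jgf d μ0 (α, b) = 1 := (hS (α, b)).unique (h0.of_eq (fun z => by rw [hf]; ring) rfl)
    refine ⟨h1.le, fun z => ?_⟩
    simp only [hfun, if_pos h1, hexp0]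
    rw [hf]; ring
  have hlt : jgf d μ0 (α, b) < 1 := by
    obtain ⟨w, hw2, hw⟩ := exists_up_step_boundary H.irred
    obtain ⟨z, rfl⟩ := exists_toZ_eq (by omega : 0 ≤ w.2)
    refine hasSum_lt (i := z) (fun z' => ?_) ?_ (hS (α, b)) h0
    · refine mul_le_mul_of_nonneg_left ?_ (stepR_nonneg H.prob H.prob0 _ _)
      rw [hf]
      refine le_mul_of_one_le_right (Real.exp_pos _).le (le_add_of_nonneg_right ?_)
      positivity
    · have h1 : stepR d μ μ0 0 z = μ0 (toZ d z) := by
        rw [stepR_eq, hjump]; congr 1; simp [toZ]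
      refine mul_lt_mul_of_pos_left ?_ (h1 ▸ hw)
      rw [hf]
      refine lt_mul_of_one_lt_right (Real.exp_pos _) (lt_add_of_pos_right _ (mul_pos hBpos ?_))
      have hz : z.2 ≠ 0 := by
        have : (1 : ℤ) ≤ z.2 := hw2
        omega
      exact Finset.sum_pos (fun i _ => by positivity) (by simpa using hz)
  refine ⟨hlt.le, fun z => ?_⟩
  have hne : 1 - jgf d μ0 (α, b) ≠ 0 := (sub_pos.2 hlt).ne'
  rcases hcase with h | ⟨rfl, rfl⟩ | ⟨hsb, rfl⟩
  · exact absurd h hBpos.ne'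
  · have hT := H.hasSum_stepR_mul_exp 0 (α, s)
    simp only [hexp0, hjump, one_mul, Prod.snd_zero, Nat.cast_zero, zero_mul, zero_add] at hT
    have h1 : jgf d μ0 (α, s) + B * jgfDβ d μ0 (α, s) = 1 := by
      refine ((hS (α, s)).add (hT.mul_left B)).unique (h0.of_eq (fun z => ?_) rfl)
      rw [hf]
      simp only [one_pow, Finset.sum_const, Finset.card_range, nsmul_eq_mul, mul_one]
      ring
    have hD := (H.jgfDβ_boundary_pos (α, s)).ne'
    have h2 : B = (1 - jgf d μ0 (α, s)) / jgfDβ d μ0 (α, s) := by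
      rw [eq_div_iff hD]; linarith
    simp only [hfun, if_neg hlt.ne, if_true, hexp0]
    rw [hf, h2]
    simp only [one_pow, Finset.sum_const, Finset.card_range, nsmul_eq_mul, mul_one,
      Prod.snd_zero, Nat.cast_zero, zero_add]
    field_simp
    ring
  · have hgeom : ∀ z : St d, f z = (1 - B / (Real.exp (s - b) - 1)) *
        Real.exp (dotZ d (α, b) (toZ d z)) +
        B / (Real.exp (s - b) - 1) * Real.exp (dotZ d (α, s) (toZ d z)) := fun z => by
      have h1 : Real.exp (s - b) ≠ 1 := by
        rw [Ne, Real.exp_eq_one_iff]; exact sub_ne_zero.2 hsb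
      rw [hf, geom_sum_eq h1, dotZ_vert α b s, Real.exp_add, ← Real.exp_nat_mul]
      have h2 : (((toZ d z).2 : ℤ) : ℝ) = z.2 := by simp [toZ]
      rw [h2, mul_comm (z.2 : ℝ)]
      have := sub_ne_zero.2 h1
      field_simp
      ring
    set K := B / (Real.exp (s - b) - 1)
    have h1 : (1 - K) * jgf d μ0 (α, b) + K * jgf d μ0 (α, s) = 1 :=
      (((hS (α, b)).mul_left _).add ((hS (α, s)).mul_left _)).unique
        (h0.of_eq (fun z => by rw [hgeom]; ring) rfl)
    have hne' : ((α, s) : Rd d) ≠ (α, b) := fun h => hsb (congrArg Prod.snd h)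
    simp only [hfun, if_neg hlt.ne, if_neg hne', hexp0]
    rw [hgeom]
    field_simp
    linear_combination (Real.exp (dotZ d (α, b) (toZ d z)) - Real.exp (dotZ d (α, s) (toZ d z))) * h1

end Hyp

/-! ### Integral representation over a compact set containing the extreme points -/

theorem exists_representing_measure {ι : Type*} [Countable ι] {K F : Set (ι → ℝ)}
    (hK : IsCompact K) (hconv : Convex ℝ K) (hF : IsCompact F) (hext : K.extremePoints ℝ ⊆ F)
    {x : ι → ℝ} (hx : x ∈ K) :
    ∃ P : Measure F, IsProbabilityMeasure P ∧ ∀ i, ∫ f, f.1 i ∂P = x i := by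
  have hcompact : CompactSpace F := isCompact_iff_compactSpace.1 hF
  have hev : ∀ i, Continuous fun f : F => f.1 i := fun i =>
    (continuous_apply i).comp continuous_subtype_val
  set Φ : ProbabilityMeasure F → ι → ℝ := fun P i => ∫ f, f.1 i ∂(P : Measure F) with hΦ
  have hcont : Continuous Φ := continuous_pi fun i =>
    ProbabilityMeasure.continuous_integral_boundedContinuousFunction
      (BoundedContinuousFunction.mkOfCompact ⟨_, hev i⟩)
  have hinteg : ∀ (P : Measure F) [IsFiniteMeasure P] (i : ι), Integrable (fun f : F => f.1 i) P :=
    fun P _ i => (hev i).integrable_of_hasCompactSupport (HasCompactSupport.of_compactSpace _)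
  have hrange : Convex ℝ (Set.range Φ) := by
    rintro _ ⟨P, rfl⟩ _ ⟨Q, rfl⟩ a b ha hb hab
    have hprob : IsProbabilityMeasure
        (ENNReal.ofReal a • (P : Measure F) + ENNReal.ofReal b • (Q : Measure F)) :=
      ⟨by simp [← ENNReal.ofReal_add ha hb, hab]⟩
    refine ⟨⟨_, hprob⟩, funext fun i => ?_⟩
    have hP := (hinteg (P : Measure F) i).smul_measure (c := ENNReal.ofReal a) ENNReal.ofReal_ne_top
    have hQ := (hinteg (Q : Measure F) i).smul_measure (c := ENNReal.ofReal b) ENNReal.ofReal_ne_top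
    simp only [hΦ, ProbabilityMeasure.coe_mk, integral_add_measure hP hQ, integral_smul_measure,
      ENNReal.toReal_ofReal ha, ENNReal.toReal_ofReal hb, Pi.add_apply, Pi.smul_apply]
  have hdirac : K.extremePoints ℝ ⊆ Set.range Φ := fun f hf => by
    refine ⟨⟨Measure.dirac (⟨f, hext hf⟩ : F), inferInstance⟩, funext fun i => ?_⟩
    simp only [hΦ, ProbabilityMeasure.coe_mk]
    exact integral_dirac' _ _ (hev i).stronglyMeasurable
  have hsub : K ⊆ Set.range Φ := by
    rw [← closure_convexHull_extremePoints hK hconv]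
    exact closure_minimal (convexHull_min hdirac hrange) (isCompact_range hcont).isClosed
  obtain ⟨P, rfl⟩ := hsub hx
  exact ⟨P, inferInstance, fun i => rfl⟩

/-- Normalized nonnegative harmonic functions. -/
def harmonicBase (d : ℕ) (μ μ0 : Zd d → ℝ) : Set (St d → ℝ) :=
  {f | (∀ z, 0 ≤ f z) ∧ IsHarmonic d μ μ0 f ∧ f 0 = 1}

/-- Normalized nonnegative harmonic functions that are multiplicative along horizontal shifts. -/
def multBase (d : ℕ) (μ μ0 : Zd d → ℝ) : Set (St d → ℝ) :=
  {f | f ∈ harmonicBase d μ μ0 ∧ ∀ x z, f (z + (x, 0)) = f (x, 0) * f z}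

namespace Hyp

variable {d : ℕ} {μ μ0 : Zd d → ℝ}

theorem exists_growth_bound (H : Hyp d μ μ0) :
    ∃ κ : ℝ, 0 ≤ κ ∧ ∀ f ∈ harmonicBase d μ μ0, ∀ z, f z ≤ Real.exp (κ * l1 (toZ d z)) := by
  choose C hC hCh using harnack_shift H.prob H.prob0 H.skipFree H.irred H.irred_free
  set κ := ∑ i, C (Pi.single i 1, 0) + ∑ i, C (Pi.single i (-1), 0) + C (0, 1) with hκ
  have hn1 : 0 ≤ ∑ i, C (Pi.single i 1, 0) := Finset.sum_nonneg fun i _ => (hC _).le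
  have hn2 : 0 ≤ ∑ i, C (Pi.single i (-1), 0) := Finset.sum_nonneg fun i _ => (hC _).le
  have hn3 := (hC (0, 1)).le
  have hκ0 : 0 ≤ κ := by linarith
  refine ⟨κ, hκ0, fun f ⟨hf, hharm, hone⟩ => ?_⟩
  have hmulti : ∀ v, C v ≤ κ → ∀ (n : ℕ) z, f (z + n • v) ≤ Real.exp (κ * n) * f z := by
    intro v hv n z
    induction n with
    | zero => simp
    | succ n ih =>
      have h1 := hCh v f hf hharm (z + n • v)
      rw [add_assoc, ← succ_nsmul] at h1
      have h2 : C v ≤ Real.exp κ := hv.trans ((le_add_of_nonneg_right zero_le_one).trans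
        (Real.add_one_le_exp κ))
      calc f (z + (n + 1) • v) ≤ C v * f (z + n • v) := h1
        _ ≤ Real.exp κ * (Real.exp (κ * n) * f z) := by
          have := hf (z + n • v)
          gcongr
        _ = Real.exp (κ * (n + 1 : ℕ)) * f z := by
          rw [← mul_assoc, ← Real.exp_add]; push_cast; ring_nf
  have hsingle : ∀ (i : Fin (d - 1)) (k : ℤ) z,
      f (z + (Pi.single i k, 0)) ≤ Real.exp (κ * |(k : ℝ)|) * f z := by
    intro i k z
    obtain ⟨n, rfl | rfl⟩ := k.eq_nat_or_neg
    · have h1 := hmulti (Pi.single i 1, 0) (by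
        have := Finset.single_le_sum (f := fun i => C (Pi.single i 1, 0))
          (fun i _ => (hC _).le) (Finset.mem_univ i)
        linarith) n z
      have h2 : n • ((Pi.single i 1, 0) : St d) = (Pi.single i (n : ℤ), 0) := by
        refine Prod.ext (funext fun j => ?_) (by simp)
        simp [Pi.single_apply]
      rw [h2] at h1
      simpa using h1
    · have h1 := hmulti (Pi.single i (-1), 0) (by
        have := Finset.single_le_sum (f := fun i => C (Pi.single i (-1), 0))
          (fun i _ => (hC _).le) (Finset.mem_univ i)
        linarith) n z
      have h2 : n • ((Pi.single i (-1), 0) : St d) = (Pi.single i (-(n : ℤ)), 0) := by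
        refine Prod.ext (funext fun j => ?_) (by simp)
        simp [Pi.single_apply]
      rw [h2] at h1
      simpa using h1
  have hhor : ∀ (x : Fin (d - 1) → ℤ) (s : Finset (Fin (d - 1))),
      f (∑ i ∈ s, Pi.single i (x i), 0) ≤ Real.exp (κ * ∑ i ∈ s, |(x i : ℝ)|) := by
    intro x s
    induction s using Finset.induction_on with
    | empty =>
      have h1 : f ((0, 0) : St d) = 1 := hone
      simp [h1]
    | insert i s hi ih =>
      rw [Finset.sum_insert hi, Finset.sum_insert hi, mul_add, Real.exp_add, add_comm]
      have h1 := hsingle i (x i) (∑ i ∈ s, Pi.single i (x i), 0)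
      rw [Prod.mk_add_mk, add_zero] at h1
      exact h1.trans (mul_le_mul_of_nonneg_left ih (Real.exp_pos _).le)
  intro z
  have h1 := hmulti (0, 1) (by linarith) z.2 (z.1, 0)
  have h2 := hhor z.1 Finset.univ
  rw [Finset.univ_sum_single] at h2
  have h3 : ((z.1, 0) : St d) + z.2 • (0, 1) = z := by simp
  rw [h3] at h1
  refine h1.trans ((mul_le_mul_of_nonneg_left h2 (Real.exp_pos _).le).trans (le_of_eq ?_))
  rw [← Real.exp_add, l1]
  simp only [toZ, Int.cast_natCast, Nat.abs_cast]
  ring_nf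

theorem summable_step_exp_l1 (H : Hyp d μ μ0) {κ : ℝ} (hκ : 0 ≤ κ) (z : St d) :
    Summable fun z' => stepR d μ μ0 z z' * Real.exp (κ * l1 (toZ d z')) := by
  have h1 : Summable fun w => jump μ μ0 z w * Real.exp (κ * l1 (toZ d z + w)) := by
    refine summable_weighted (jump_nonneg H.prob H.prob0 z) (H.summable_jump z) (κ := κ)
      (C := Real.exp (κ * l1 (toZ d z))) fun w => ?_
    rw [Real.abs_exp, ← Real.exp_add, ← mul_add]
    exact Real.exp_le_exp.2 (mul_le_mul_of_nonneg_left (l1_add_le _ _) hκ)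
  exact ((hasSum_stepR H.skipFree z (fun v => Real.exp (κ * l1 v)) _).2 h1.hasSum).summable

theorem isCompact_harmonicBase (H : Hyp d μ μ0) : IsCompact (harmonicBase d μ μ0) := by
  obtain ⟨κ, hκ, hbound⟩ := H.exists_growth_bound
  set box : Set (St d → ℝ) := Set.univ.pi fun z => Set.Icc 0 (Real.exp (κ * l1 (toZ d z))) with hbox
  have hboxc : IsCompact box := isCompact_univ_pi fun z => isCompact_Icc
  have hdom : ∀ z, ∀ z' : St d, ∀ f ∈ box,
      ‖stepR d μ μ0 z z' * f z'‖ ≤ stepR d μ μ0 z z' * Real.exp (κ * l1 (toZ d z')) :=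
    fun z z' f hf => by
      have h1 := hf z' (Set.mem_univ _)
      rw [Real.norm_eq_abs, abs_of_nonneg (mul_nonneg (stepR_nonneg H.prob H.prob0 z z') h1.1)]
      exact mul_le_mul_of_nonneg_left h1.2 (stepR_nonneg H.prob H.prob0 z z')
  have hset : harmonicBase d μ μ0 = (⋂ z, box ∩
      {f | ∑' z', stepR d μ μ0 z z' * f z' - f z ∈ ({0} : Set ℝ)}) ∩ {f | f 0 = 1} := by
    ext f
    constructor
    · intro hf
      refine ⟨Set.mem_iInter.2 fun z => ⟨fun z _ => ⟨hf.1 z, hbound f hf z⟩, ?_⟩, hf.2.2⟩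
      exact sub_eq_zero.2 (hf.2.1 z).tsum_eq
    · rintro ⟨h1, h2⟩
      rw [Set.mem_iInter] at h1
      refine ⟨fun z => ((h1 z).1 z (Set.mem_univ _)).1, fun z => ?_, h2⟩
      have h3 := (Summable.of_norm_bounded (H.summable_step_exp_l1 hκ z)
        fun z' => hdom z z' f (h1 z).1).hasSum
      rwa [sub_eq_zero.1 (h1 z).2] at h3
  have hclosed : IsClosed (harmonicBase d μ μ0) := by
    rw [hset]
    refine (isClosed_iInter fun z => ?_).inter (isClosed_eq (continuous_apply 0) continuous_const)
    refine ContinuousOn.preimage_isClosed_of_isClosed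
      (f := fun f : St d → ℝ => ∑' z', stepR d μ μ0 z z' * f z' - f z) (ContinuousOn.sub ?_
        (continuous_apply z).continuousOn) hboxc.isClosed isClosed_singleton
    exact continuousOn_tsum (fun z' => (continuous_const.mul (continuous_apply z')).continuousOn)
      (H.summable_step_exp_l1 hκ z) fun z' f hf => hdom z z' f hf
  exact hboxc.of_isClosed_subset hclosed fun f hf z _ => ⟨hf.1 z, hbound f hf z⟩

theorem isCompact_multBase (H : Hyp d μ μ0) : IsCompact (multBase d μ μ0) := by
  have : multBase d μ μ0 = harmonicBase d μ μ0 ∩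
      ⋂ x, ⋂ z, {f | f (z + (x, 0)) = f (x, 0) * f z} := by
    ext f; simp [multBase]
  rw [this]
  exact H.isCompact_harmonicBase.inter_right (isClosed_iInter fun x => isClosed_iInter fun z =>
    isClosed_eq (continuous_apply _) ((continuous_apply ((x, 0) : St d)).mul (continuous_apply z)))

theorem convex_harmonicBase : Convex ℝ (harmonicBase d μ μ0) := by
  rintro f ⟨hf, hfh, hf1⟩ g ⟨hg, hgh, hg1⟩ a b ha hb hab
  refine ⟨fun z => add_nonneg (mul_nonneg ha (hf z)) (mul_nonneg hb (hg z)), fun z => ?_, ?_⟩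
  · refine (((hfh z).mul_left a).add ((hgh z).mul_left b)).of_eq (fun z' => ?_) rfl
    simp only [Pi.add_apply, Pi.smul_apply, smul_eq_mul]
    ring
  · simp [hf1, hg1, hab]

theorem pos_of_mem (H : Hyp d μ μ0) {f : St d → ℝ} (hf : f ∈ harmonicBase d μ μ0) (z : St d) :
    0 < f z :=
  hf.2.1.pos H.prob H.prob0 H.irred hf.1 (w := 0) (by rw [hf.2.2]; exact one_pos) z

theorem extremePoints_subset_multBase (H : Hyp d μ μ0) :
    (harmonicBase d μ μ0).extremePoints ℝ ⊆ multBase d μ μ0 := by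
  intro f hf
  obtain ⟨hfK, hext⟩ := hf
  refine ⟨hfK, fun x => ?_⟩
  have hpos := H.pos_of_mem hfK
  obtain ⟨C, hC, hCh⟩ := harnack_shift H.prob H.prob0 H.skipFree H.irred H.irred_free (x, 0)
  set t := f (x, 0) with ht
  have htpos : 0 < t := hpos _
  have hshift := hfK.2.1.shift x
  have h0 : f ((0 : St d) + (x, 0)) = t := by rw [zero_add]
  have hg1 : (fun z => t⁻¹ * f (z + (x, 0))) ∈ harmonicBase d μ μ0 := by
    refine ⟨fun z => mul_nonneg (inv_nonneg.2 htpos.le) (hpos _).le, fun z => ?_, ?_⟩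
    · exact ((hshift z).mul_left t⁻¹).of_eq (fun z' => by ring) rfl
    · simp only [h0]
      exact inv_mul_cancel₀ htpos.ne'
  have hg2 : (fun z => C⁻¹ * ((C + t) * f z - f (z + (x, 0)))) ∈ harmonicBase d μ μ0 := by
    refine ⟨fun z => mul_nonneg (inv_nonneg.2 hC.le) ?_, fun z => ?_, ?_⟩
    · have h1 := hCh f hfK.1 hfK.2.1 z
      have h2 := mul_pos htpos (hpos z)
      rw [add_mul]; linarith
    · exact ((((hfK.2.1 z).mul_left (C + t)).sub (hshift z)).mul_left C⁻¹).of_eq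
        (fun z' => by ring) rfl
    · simp only [h0, hfK.2.2]
      field_simp
      ring
  have hmem : f ∈ openSegment ℝ (fun z => t⁻¹ * f (z + (x, 0)))
      (fun z => C⁻¹ * ((C + t) * f z - f (z + (x, 0)))) := by
    refine ⟨t / (C + t), C / (C + t), by positivity, by positivity, by field_simp; ring,
      funext fun z => ?_⟩
    simp only [Pi.add_apply, Pi.smul_apply, smul_eq_mul]
    field_simp
    ring
  intro z
  have h1 := congrFun (hext hg1 hg2 hmem) z
  rw [← h1, mul_inv_cancel_left₀ htpos.ne']

theorem exists_param_of_mem (H : Hyp d μ μ0) {f : St d → ℝ} (hf : f ∈ multBase d μ μ0) :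
    section1 (bdPlus d μ) (slope f) ∈ paramSet d μ μ0 ∧
      ∀ z, hfun d μ μ0 (section1 (bdPlus d μ) (slope f))
        (abarF d μ (section1 (bdPlus d μ) (slope f))) z =
        f z * hfun d μ μ0 (section1 (bdPlus d μ) (slope f))
          (abarF d μ (section1 (bdPlus d μ) (slope f))) 0 := by
  obtain ⟨b, s, hb, hs, h0, hform⟩ :=
    H.exists_param hf.1.2.1 (H.pos_of_mem hf.1) hf.1.2.2 hf.2
  have h1 : section1 (bdPlus d μ) (slope f) = (slope f, s) := section1_eq H.injOn_bdPlus hs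
  have h2 : abarF d μ (slope f, s) = (slope f, b) := H.abarF_eq hb rfl
  rw [h1, h2]
  exact ⟨H.mem_paramSet_iff.2 ⟨hs, h2 ▸ h0⟩, hform⟩

theorem exists_measure (H : Hyp d μ μ0) {h : St d → ℝ} (hh : ∀ z, 0 ≤ h z)
    (hharm : IsHarmonic d μ μ0 h) :
    ∃ ν : Measure (Rd d), ∀ z, h z =
      ∫ a in paramSet d μ μ0, hfun d μ μ0 a (abarF d μ a) z ∂ν := by
  rcases (hh 0).eq_or_lt with h0 | h0
  · refine ⟨0, fun z => ?_⟩
    rw [Measure.restrict_zero, integral_zero_measure]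
    by_contra hne
    exact (hharm.pos H.prob H.prob0 H.irred hh ((hh z).lt_of_ne (Ne.symm hne)) 0).ne h0
  have hK : (fun z => (h 0)⁻¹ * h z) ∈ harmonicBase d μ μ0 :=
    ⟨fun z => mul_nonneg (inv_nonneg.2 h0.le) (hh z),
      fun z => ((hharm z).mul_left (h 0)⁻¹).of_eq (fun z' => by ring) rfl,
      inv_mul_cancel₀ h0.ne'⟩
  obtain ⟨P, hP, hrep⟩ := exists_representing_measure H.isCompact_harmonicBase
    convex_harmonicBase H.isCompact_multBase H.extremePoints_subset_multBase hK
  have hev : ∀ z, Measurable fun f : multBase d μ μ0 => f.1 z := fun z =>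
    (measurable_pi_apply z).comp measurable_subtype_coe
  set A : multBase d μ μ0 → Rd d := fun f => section1 (bdPlus d μ) (slope f.1) with hA
  have hAm : Measurable A := (measurable_section1 H.measurableSet_bdPlus H.injOn_bdPlus).comp
    (measurable_pi_lambda _ fun i => Real.measurable_log.comp (hev _))
  have hAmem : ∀ f, A f ∈ paramSet d μ μ0 := fun f => (H.exists_param_of_mem f.2).1
  set ρ : multBase d μ μ0 → ℝ≥0∞ := fun f =>
    ENNReal.ofReal (h 0 / hfun d μ μ0 (A f) (abarF d μ (A f)) 0) with hρ
  have hρm : Measurable ρ :=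
    (measurable_const.div ((H.measurable_hfun 0).comp hAm)).ennreal_ofReal
  refine ⟨(P.withDensity ρ).map A, fun z => ?_⟩
  have hgm : Measurable fun a => ENNReal.ofReal (hfun d μ μ0 a (abarF d μ a) z) :=
    (H.measurable_hfun z).ennreal_ofReal
  have hpre : A ⁻¹' paramSet d μ μ0 = Set.univ := Set.eq_univ_of_forall hAmem
  rw [H.integral_hfun, setLIntegral_map H.measurableSet_paramSet hgm hAm, hpre,
    Measure.restrict_univ]
  have hpt : ∀ f, (ρ * ((fun a => ENNReal.ofReal (hfun d μ μ0 a (abarF d μ a) z)) ∘ A)) f =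
      ENNReal.ofReal (h 0 * f.1 z) := fun f => by
    have h1 := H.hfun_pos_of_mem (hAmem f) 0
    have h2 := (H.exists_param_of_mem f.2).2 z
    simp only [Pi.mul_apply, Function.comp_apply, hρ]
    rw [← ENNReal.ofReal_mul (by positivity)]
    congr 1
    change hfun d μ μ0 (A f) (abarF d μ (A f)) z =
      f.1 z * hfun d μ μ0 (A f) (abarF d μ (A f)) 0 at h2
    rw [h2]
    field_simp
  have hnn : ∀ f : multBase d μ μ0, 0 ≤ h 0 * f.1 z := fun f => mul_nonneg h0.le (f.2.1.1 z)
  have hw := lintegral_withDensity_eq_lintegral_mul P hρm (hgm.comp hAm)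
  rw [lintegral_congr hpt] at hw
  refine Eq.trans ?_ (congrArg ENNReal.toReal hw).symm
  rw [ ← integral_eq_lintegral_of_nonneg_ae (ae_of_all _ hnn)
    ((hev z).const_mul _).aestronglyMeasurable, integral_const_mul, hrep z,
    mul_inv_cancel_left₀ h0.ne']

end Hyp

/-- Poisson–Martin type integral representation: a nonnegative
function is harmonic iff it is the integral of the family `(h_a)` over
`(Θ×ℝ)∩∂₊D` against some positive Borel measure. -/
theorem poisson_martin_representation
    (d : ℕ) (hd : 2 ≤ d) (μ μ0 : Zd d → ℝ)
    (hμ : IsProb d μ) (hμ0 : IsProb d μ0)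
    (hH0 : H0 d μ μ0) (hH1 : H1 d μ μ0) (hH2 : H2 d μ)
    (hH3 : H3 d μ μ0) (hH4 : H4 d μ μ0) :
    ∀ h : St d → ℝ, (∀ z, 0 ≤ h z) →
      (IsHarmonic d μ μ0 h ↔
        ∃ ν : Measure (Rd d),
          ∀ z : St d,
            h z = ∫ a in {a : Rd d | a.1 ∈ Theta d μ μ0 ∧ a ∈ bdPlus d μ},
              hfun d μ μ0 a (abarF d μ a) z ∂ν) := by
  intro h hh
  have H : Hyp d μ μ0 := ⟨hμ, hμ0, hH0, hH1, hH2, hH4⟩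
  refine ⟨H.exists_measure hh, fun ⟨ν, hν⟩ => ?_⟩
  rw [funext hν]
  exact H.isHarmonic_integral ν

end ReflectedRW
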